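/- Shape of the reachable set: Let σ be a turn sequence containing at least one hook. For each signed axis met by A(σ), let (x⁺_σ,0), (x⁻_σ,0), (0,y⁺_σ), (0,y⁻_σ) denote the reachable points on the +x-, −x-, +y-, −y-axis, respectively, that are closest to the origin (these exist exactly when σ contains a right, left, up, down hook, respectively). Then A(σ) is exactly the union of the halfplanes V⁺((x⁺_σ,0)) and V⁺((x⁻_σ,0)) (over those of x⁺_σ, x⁻_σ that exist) together with the halfplanes H⁺((0,y⁺_σ)) and H⁺((0,y⁻_σ)) (over those of y⁺_σ, y⁻_σ that exist). -/

import Mathlib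

/-- A turn: left (`L`) or right (`R`). -/
inductive Turn : Type
  | L : Turn
  | R : Turn
  deriving DecidableEq

/-- Rotation of a direction vector by 90° counterclockwise. -/
def rotCCW (d : ℤ × ℤ) : ℤ × ℤ := (-d.2, d.1)

/-- Rotation of a direction vector by 90° clockwise. -/
def rotCW (d : ℤ × ℤ) : ℤ × ℤ := (d.2, -d.1)

/-- Unit direction of the axis-parallel segment from `u` to `v`. -/
def unitDir (u v : ℤ × ℤ) : ℤ × ℤ := ((v.1 - u.1).sign, (v.2 - u.2).sign)

/-- The set of integer points on the axis-parallel closed segment from `u` to `v`. -/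
def segSet (u v : ℤ × ℤ) : Set (ℤ × ℤ) :=
  {q | min u.1 v.1 ≤ q.1 ∧ q.1 ≤ max u.1 v.1 ∧ min u.2 v.2 ≤ q.2 ∧ q.2 ≤ max u.2 v.2}

/-- A simple rectilinear chain realizing the turn sequence `σ = σ₁⋯σₙ` (as a list,
`σ.get ⟨i, _⟩` is the `(i+1)`-st turn `σ_{i+1}`).  It consists of the points
`pts 0, …, pts (n+1)` with `pts 0 = (0,0)`; consecutive points span nondegenerate
axis-parallel segments, the first segment heads east, the chain turns left (CCW) or
right (CW) at each bend as prescribed by `σ`, and the chain is simple. -/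
structure Chain (σ : List Turn) where
  pts : ℕ → ℤ × ℤ
  start_eq : pts 0 = (0, 0)
  first_seg : ∃ t : ℤ, 0 < t ∧ pts 1 = (t, 0)
  axis_parallel : ∀ i ≤ σ.length,
    ((pts (i + 1)).1 = (pts i).1 ∧ (pts (i + 1)).2 ≠ (pts i).2) ∨
    ((pts (i + 1)).2 = (pts i).2 ∧ (pts (i + 1)).1 ≠ (pts i).1)
  turns : ∀ i, ∀ h : i < σ.length,
    unitDir (pts (i + 1)) (pts (i + 2)) =
      (if σ.get ⟨i, h⟩ = Turn.L then rotCCW else rotCW) (unitDir (pts i) (pts (i + 1)))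
  simple_adj : ∀ i, i + 1 ≤ σ.length →
    segSet (pts i) (pts (i + 1)) ∩ segSet (pts (i + 1)) (pts (i + 2)) = {pts (i + 1)}
  simple_nonadj : ∀ i j, i + 1 < j → j ≤ σ.length →
    segSet (pts i) (pts (i + 1)) ∩ segSet (pts j) (pts (j + 1)) = ∅

/-- `A(σ)`: the set of points reachable by the turn sequence `σ`. -/
def ReachSet (σ : List Turn) : Set (ℤ × ℤ) :=
  {q | ∃ C : Chain σ, C.pts (σ.length + 1) = q}

/-- The halfplane `V⁺(p)` (requires `p.1 ≠ 0` to be meaningful). -/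
def Vplus (p : ℤ × ℤ) : Set (ℤ × ℤ) :=
  {q | ∃ i j : ℤ, 0 ≤ i ∧ q = (p.1 + p.1.sign * i, j)}

/-- The halfplane `H⁺(p)` (requires `p.2 ≠ 0` to be meaningful). -/
def Hplus (p : ℤ × ℤ) : Set (ℤ × ℤ) :=
  {q | ∃ i j : ℤ, 0 ≤ j ∧ q = (i, p.2 + p.2.sign * j)}

/-- The quadrant `Q⁺(p)`. -/
def Qplus (p : ℤ × ℤ) : Set (ℤ × ℤ) := Vplus p ∩ Hplus p

/-- A staircase: consecutive turns always differ. -/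
def IsStaircase (σ : List Turn) : Prop := σ.Chain' (· ≠ ·)

/-- The prefix number `δᵢ`: number of `L`s minus number of `R`s among the first `i` turns. -/
def delta (σ : List Turn) (i : ℕ) : ℤ :=
  ((σ.take i).count Turn.L : ℤ) - ((σ.take i).count Turn.R : ℤ)

/-- The excess number `l - r` of a turn sequence. -/
def excess (σ : List Turn) : ℤ := (σ.count Turn.L : ℤ) - (σ.count Turn.R : ℤ)

/-- `σ` has a hook (two equal consecutive turns, at 1-based positions `k+1, k+2`)
whose prefix number is `≡ d (mod 4)`: `d = 0, 1, 2, 3` for right, up, left, down hooks. -/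
def HasHook (σ : List Turn) (d : ℤ) : Prop :=
  ∃ k, ∃ h : k + 1 < σ.length,
    σ.get ⟨k, by omega⟩ = σ.get ⟨k + 1, h⟩ ∧ delta σ (k + 1) % 4 = d

/-- `σ` has some hook, i.e. two equal consecutive turns. -/
def HasAnyHook (σ : List Turn) : Prop :=
  ∃ k, ∃ h : k + 1 < σ.length, σ.get ⟨k, by omega⟩ = σ.get ⟨k + 1, h⟩

/-- A set `S ⊆ ℤ²` is connected: any two points of `S` are joined by a path inside `S`
whose consecutive points are at `L¹`-distance `1`. -/
def GridConnected (S : Set (ℤ × ℤ)) : Prop :=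
  ∀ p ∈ S, ∀ q ∈ S, ∃ (n : ℕ) (f : ℕ → ℤ × ℤ),
    f 0 = p ∧ f n = q ∧ (∀ i ≤ n, f i ∈ S) ∧
    ∀ i < n, |(f (i + 1)).1 - (f i).1| + |(f (i + 1)).2 - (f i).2| = 1

/-- `q` lies on the boundary of the smallest axis-parallel bounding box of the chain `C`
(for `q` a point of the chain: it attains an extreme coordinate). -/
def OnBBoxBoundary (σ : List Turn) (C : Chain σ) (q : ℤ × ℤ) : Prop :=
  (∀ i ≤ σ.length + 1, q.1 ≤ (C.pts i).1) ∨ (∀ i ≤ σ.length + 1, (C.pts i).1 ≤ q.1) ∨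
  (∀ i ≤ σ.length + 1, q.2 ≤ (C.pts i).2) ∨ (∀ i ≤ σ.length + 1, (C.pts i).2 ≤ q.2)

/-- The last segment of the chain `C` is entirely contained in one side of the smallest
axis-parallel bounding box of `C`. -/
def LastSegOnSide (σ : List Turn) (C : Chain σ) : Prop :=
  ((C.pts σ.length).1 = (C.pts (σ.length + 1)).1 ∧
     ∀ i ≤ σ.length + 1, (C.pts σ.length).1 ≤ (C.pts i).1) ∨
  ((C.pts σ.length).1 = (C.pts (σ.length + 1)).1 ∧
     ∀ i ≤ σ.length + 1, (C.pts i).1 ≤ (C.pts σ.length).1) ∨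
  ((C.pts σ.length).2 = (C.pts (σ.length + 1)).2 ∧
     ∀ i ≤ σ.length + 1, (C.pts σ.length).2 ≤ (C.pts i).2) ∨
  ((C.pts σ.length).2 = (C.pts (σ.length + 1)).2 ∧
     ∀ i ≤ σ.length + 1, (C.pts i).2 ≤ (C.pts σ.length).2)

/-- The turn `σₘ` (1-based indexing). -/
def turnAt (σ : List Turn) (m : ℕ) : Turn := σ.getD (m - 1) Turn.L

/-- The suffix `σ_k ⋯ σ_n` contains no hook and all its prefix numbers `δᵢ`,
`k - 1 ≤ i ≤ n`, are `≡ 1` or `2 (mod 4)` (the combinatorial description of a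
NW-staircase containing the endpoint). -/
def GoodSuffix (σ : List Turn) (k : ℕ) : Prop :=
  1 ≤ k ∧ k ≤ σ.length ∧
  (∀ m : ℕ, k ≤ m → m < σ.length → turnAt σ m ≠ turnAt σ (m + 1)) ∧
  (∀ i : ℕ, k - 1 ≤ i → i ≤ σ.length → delta σ i % 4 = 1 ∨ delta σ i % 4 = 2)

open Classical in
/-- `₋ₓm₊ᵧᵖ(σ)`: taking the longest good suffix (i.e. the least `k` with
`GoodSuffix σ k`), the number of indices `i` with `k - 1 ≤ i ≤ n` and
`δᵢ ≡ 1 (mod 4)`; `0` if no good suffix exists. -/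
noncomputable def mNWp (σ : List Turn) : ℕ :=
  if ∃ k, GoodSuffix σ k then
    Nat.card {i : ℕ // sInf {k | GoodSuffix σ k} - 1 ≤ i ∧ i ≤ σ.length ∧
      delta σ i % 4 = 1}
  else 0

/-- The number of vertical segments of the chain `C` meeting the closed horizontal
segment from the origin to `(a, 0)`. -/
def verticalCrossCount (σ : List Turn) (C : Chain σ) (a : ℤ) : ℕ :=
  ((Finset.range (σ.length + 1)).filter fun i =>
    (C.pts i).1 = (C.pts (i + 1)).1 ∧
    0 ≤ (C.pts i).1 ∧ (C.pts i).1 ≤ a ∧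
    min (C.pts i).2 (C.pts (i + 1)).2 ≤ 0 ∧ 0 ≤ max (C.pts i).2 (C.pts (i + 1)).2).card

/-- The unit direction of the `(i+1)`-st segment of the chain `C`. -/
def dirOf (σ : List Turn) (C : Chain σ) (i : ℕ) : ℤ × ℤ := unitDir (C.pts i) (C.pts (i + 1))

/-- `z₁mz₂ᵒ(C)`: the number of `z₂`-segments in the maximal `(z₁,z₂)`-staircase subchain
of `C` containing the origin (the longest prefix of segments directed `z₁` or `z₂`);
`0` if no such subchain exists. -/
noncomputable def stairCountO (σ : List Turn) (C : Chain σ) (z₁ z₂ : ℤ × ℤ) : ℕ :=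
  Nat.card {i : ℕ // i ≤ σ.length ∧ dirOf σ C i = z₂ ∧
    ∀ j ≤ i, dirOf σ C j = z₁ ∨ dirOf σ C j = z₂}

/-- `z₁mz₂ᵖ(C)`: the number of `z₂`-segments in the maximal `(z₁,z₂)`-staircase subchain
of `C` containing the endpoint (the longest suffix of segments directed `z₁` or `z₂`);
`0` if no such subchain exists. -/
noncomputable def stairCountP (σ : List Turn) (C : Chain σ) (z₁ z₂ : ℤ × ℤ) : ℕ :=
  Nat.card {i : ℕ // i ≤ σ.length ∧ dirOf σ C i = z₂ ∧
    ∀ j, i ≤ j → j ≤ σ.length → dirOf σ C j = z₁ ∨ dirOf σ C j = z₂}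

namespace TurnChain

/-- The segment from `u` to `v` is nondegenerate and points in direction `d` (a multiple of 90°
counted counterclockwise from east). -/
def IsStep (d : ℤ) (u v : ℤ × ℤ) : Prop :=
  (d % 4 = 0 ∧ v.2 = u.2 ∧ u.1 < v.1) ∨ (d % 4 = 1 ∧ v.1 = u.1 ∧ u.2 < v.2) ∨
  (d % 4 = 2 ∧ v.2 = u.2 ∧ v.1 < u.1) ∨ (d % 4 = 3 ∧ v.1 = u.1 ∧ v.2 < u.2)

/-- `P 0, …, P (n + 1)` is a rectilinear chain with directions `D 0, …, D n` whose nonadjacent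
segments are disjoint. -/
structure IsRealization (n : ℕ) (D : ℕ → ℤ) (P : ℕ → ℤ × ℤ) : Prop where
  isStep : ∀ i ≤ n, IsStep (D i) (P i) (P (i + 1))
  disjoint : ∀ i j, i + 1 < j → j ≤ n → ∀ q,
    q ∈ segSet (P i) (P (i + 1)) → q ∉ segSet (P j) (P (j + 1))

/-- Consecutive directions differ by 90°. -/
def IsTurnWord (n : ℕ) (D : ℕ → ℤ) : Prop :=
  ∀ i < n, D (i + 1) = D i + 1 ∨ D (i + 1) = D i - 1

/-- The displacements realized by chains with directions `D 0, …, D n`. -/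
def Reach (n : ℕ) (D : ℕ → ℤ) : Set (ℤ × ℤ) :=
  {q | ∃ P, IsRealization n D P ∧ (P (n + 1)).1 = (P 0).1 + q.1 ∧ (P (n + 1)).2 = (P 0).2 + q.2}

/-- Some segment of direction `d`, other than the first and the last, has equal turns at its
ends. -/
def Hook (n : ℕ) (D : ℕ → ℤ) (d : ℤ) : Prop :=
  ∃ k, k + 2 ≤ n ∧ D (k + 2) ≠ D k ∧ D (k + 1) % 4 = d

variable {n : ℕ} {D : ℕ → ℤ} {P : ℕ → ℤ × ℤ}

theorem mem_segSet {u v q : ℤ × ℤ} : q ∈ segSet u v ↔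
    min u.1 v.1 ≤ q.1 ∧ q.1 ≤ max u.1 v.1 ∧ min u.2 v.2 ≤ q.2 ∧ q.2 ≤ max u.2 v.2 := Iff.rfl

theorem IsStep.even {d : ℤ} {u v : ℤ × ℤ} (h : IsStep d u v) (hd : d % 2 = 0) :
    v.2 = u.2 ∧ u.1 ≠ v.1 := by
  unfold IsStep at h; omega

theorem IsStep.odd {d : ℤ} {u v : ℤ × ℤ} (h : IsStep d u v) (hd : d % 2 = 1) :
    v.1 = u.1 ∧ u.2 ≠ v.2 := by
  unfold IsStep at h; omega

namespace IsRealization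

theorem rot (h : IsRealization n D P) :
    IsRealization n (fun i => D i + 1) (fun i => (-(P i).2, (P i).1)) where
  isStep i hi := by
    have := h.isStep i hi
    simp only [IsStep] at this ⊢
    omega
  disjoint i j hij hj q h1 h2 := by
    refine h.disjoint i j hij hj (q.2, -q.1) ?_ ?_ <;> simp only [mem_segSet] at h1 h2 ⊢ <;> omega

theorem refl (h : IsRealization n D P) :
    IsRealization n (fun i => - D i) (fun i => ((P i).1, -(P i).2)) where
  isStep i hi := by
    have := h.isStep i hi
    simp only [IsStep] at this ⊢
    omega
  disjoint i j hij hj q h1 h2 := by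
    refine h.disjoint i j hij hj (q.1, -q.2) ?_ ?_ <;> simp only [mem_segSet] at h1 h2 ⊢ <;> omega

theorem swap (h : IsRealization n D P) :
    IsRealization n (fun i => 1 - D i) (fun i => (P i).swap) where
  isStep i hi := by
    have := h.isStep i hi
    simp only [IsStep, Prod.fst_swap, Prod.snd_swap] at this ⊢
    omega
  disjoint i j hij hj q h1 h2 := by
    refine h.disjoint i j hij hj q.swap ?_ ?_ <;>
      simp only [mem_segSet, Prod.fst_swap, Prod.snd_swap] at h1 h2 ⊢ <;> omega

theorem adj (h : IsRealization n D P) (hD : IsTurnWord n D) {i : ℕ} (hi : i < n) {q : ℤ × ℤ}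
    (h1 : q ∈ segSet (P i) (P (i + 1))) (h2 : q ∈ segSet (P (i + 1)) (P (i + 2))) :
    q = P (i + 1) := by
  have s1 := h.isStep i hi.le
  have s2 : IsStep (D (i + 1)) (P (i + 1)) (P (i + 2)) := h.isStep (i + 1) hi
  have := hD i hi
  simp only [mem_segSet, IsStep] at *
  ext <;> omega

theorem eq_of_mem_of_even (h : IsRealization n D P) (hD : IsTurnWord n D) {i j : ℕ} (hi : i ≤ n)
    (hj : j ≤ n) (hij : D i % 2 = D j % 2) {q : ℤ × ℤ}
    (h1 : q ∈ segSet (P i) (P (i + 1))) (h2 : q ∈ segSet (P j) (P (j + 1))) : i = j := by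
  rcases lt_trichotomy i j with hl | hl | hl
  · rcases Nat.lt_or_ge (i + 1) j with hl' | hl'
    · exact absurd h2 (h.disjoint i j hl' hj q h1)
    · obtain rfl : j = i + 1 := by omega
      have := hD i (by omega)
      omega
  · exact hl
  · rcases Nat.lt_or_ge (j + 1) i with hl' | hl'
    · exact absurd h1 (h.disjoint j i hl' hi q h2)
    · obtain rfl : i = j + 1 := by omega
      have := hD j (by omega)
      omega

theorem corner (h : IsRealization n D P) (hD : IsTurnWord n D) {i j : ℕ} (hi : i ≤ n)
    (hj : j ≤ n) (hij : i ≠ j) {q : ℤ × ℤ}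
    (h1 : q ∈ segSet (P i) (P (i + 1))) (h2 : q ∈ segSet (P j) (P (j + 1))) :
    (j = i + 1 ∧ q = P (i + 1)) ∨ (i = j + 1 ∧ q = P (j + 1)) := by
  rcases lt_or_gt_of_ne hij with hl | hl
  · rcases Nat.lt_or_ge (i + 1) j with hl' | hl'
    · exact absurd h2 (h.disjoint i j hl' hj q h1)
    · obtain rfl : j = i + 1 := by omega
      exact Or.inl ⟨rfl, h.adj hD (by omega) h1 h2⟩
  · rcases Nat.lt_or_ge (j + 1) i with hl' | hl'
    · exact absurd h1 (h.disjoint j i hl' hi q h2)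
    · obtain rfl : i = j + 1 := by omega
      exact Or.inr ⟨rfl, h.adj hD (by omega) h2 h1⟩

theorem left_mem (i : ℕ) : P i ∈ segSet (P i) (P (i + 1)) := by
  simp only [mem_segSet]; omega

theorem right_mem (i : ℕ) : P (i + 1) ∈ segSet (P i) (P (i + 1)) := by
  simp only [mem_segSet]; omega

/-- The last point lies on the last segment only. -/
theorem eq_of_last_mem (h : IsRealization n D P) (hD : IsTurnWord n D) {i : ℕ} (hi : i ≤ n)
    (h1 : P (n + 1) ∈ segSet (P i) (P (i + 1))) : i = n := by
  by_contra hne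
  rcases h.corner hD hi le_rfl hne h1 (right_mem n) with ⟨rfl, hq⟩ | ⟨rfl, -⟩
  · have := h.isStep (i + 1) le_rfl
    simp only [IsStep, hq] at this
    omega
  · omega

/-- The start of a segment lies on no later segment. -/
theorem eq_of_start_mem (h : IsRealization n D P) (hD : IsTurnWord n D) {i j : ℕ} (hij : i ≤ j)
    (hj : j ≤ n) (h1 : P i ∈ segSet (P j) (P (j + 1))) : j = i := by
  by_contra hne
  rcases h.corner hD (hij.trans hj) hj (Ne.symm hne) (left_mem i) h1 with ⟨rfl, hq⟩ | ⟨rfl, -⟩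
  · have := h.isStep i (by omega)
    simp only [IsStep, ← hq] at this
    omega
  · omega

section Displace

variable {g : ℤ × ℤ → ℤ}

theorem displace_lt (mono : ∀ x y y', y < y' → y + g (x, y) < y' + g (x, y')) {u v : ℤ × ℤ}
    (hx : u.1 = v.1) (hy : u.2 < v.2) : u.2 + g u < v.2 + g v := by
  obtain ⟨x, y⟩ := u
  obtain ⟨x', y'⟩ := v
  simp only at hx hy
  subst hx
  exact mono x y y' hy

theorem displace_bounds (h : IsRealization n D P)
    (mono : ∀ x y y', y < y' → y + g (x, y) < y' + g (x, y'))
    (hor : ∀ i ≤ n, D i % 2 = 0 → ∀ q q', q ∈ segSet (P i) (P (i + 1)) →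
      q' ∈ segSet (P i) (P (i + 1)) → g q = g q') {i : ℕ} (hi : i ≤ n) {q : ℤ × ℤ}
    (hq : q ∈ segSet ((P i).1, (P i).2 + g (P i))
      ((P (i + 1)).1, (P (i + 1)).2 + g (P (i + 1)))) :
    ∃ l u, (q.1, l) ∈ segSet (P i) (P (i + 1)) ∧ (q.1, u) ∈ segSet (P i) (P (i + 1)) ∧
      l ≤ u ∧ l + g (q.1, l) ≤ q.2 ∧ q.2 ≤ u + g (q.1, u) := by
  have s := h.isStep i hi
  simp only [mem_segSet] at hq
  rcases Int.emod_two_eq_zero_or_one (D i) with hd | hd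
  · have e := s.even hd
    have hm : (q.1, (P i).2) ∈ segSet (P i) (P (i + 1)) := by
      simp only [mem_segSet]; omega
    have e1 := hor i hi hd _ _ (left_mem i) (right_mem i)
    have e2 := hor i hi hd _ _ (left_mem i) hm
    clear hor mono
    refine ⟨(P i).2, (P i).2, hm, hm, le_rfl, ?_, ?_⟩ <;> omega
  · have e := s.odd hd
    have eq1 : (q.1, (P i).2) = P i := Prod.ext (by simp only; omega) rfl
    have eq2 : (q.1, (P (i + 1)).2) = P (i + 1) := Prod.ext (by simp only; omega) rfl
    have m1 : (q.1, (P i).2) ∈ segSet (P i) (P (i + 1)) := by rw [eq1]; exact left_mem i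
    have m2 : (q.1, (P (i + 1)).2) ∈ segSet (P i) (P (i + 1)) := by rw [eq2]; exact right_mem i
    rcases lt_or_gt_of_ne e.2 with hl | hl
    · have := displace_lt mono e.1.symm hl
      refine ⟨_, _, m1, m2, hl.le, ?_, ?_⟩
      · rw [eq1]; omega
      · rw [eq2]; omega
    · have := displace_lt mono e.1 hl
      refine ⟨_, _, m2, m1, hl.le, ?_, ?_⟩
      · rw [eq2]; omega
      · rw [eq1]; omega

theorem mem_segSet_of_between {u v : ℤ × ℤ} {x l y m : ℤ} (h1 : (x, l) ∈ segSet u v)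
    (h2 : (x, m) ∈ segSet u v) (hl : l ≤ y) (hm : y ≤ m) : (x, y) ∈ segSet u v := by
  simp only [mem_segSet] at h1 h2 ⊢
  omega

/-- Moving every point vertically by an amount that is constant along horizontal segments and
preserves the order on each column. -/
theorem displace (h : IsRealization n D P)
    (mono : ∀ x y y', y < y' → y + g (x, y) < y' + g (x, y'))
    (hor : ∀ i ≤ n, D i % 2 = 0 → ∀ q q', q ∈ segSet (P i) (P (i + 1)) →
      q' ∈ segSet (P i) (P (i + 1)) → g q = g q') :
    IsRealization n D (fun i => ((P i).1, (P i).2 + g (P i))) where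
  isStep i hi := by
    have s := h.isStep i hi
    rcases Int.emod_two_eq_zero_or_one (D i) with hd | hd
    · have := hor i hi hd _ _ (left_mem i) (right_mem i)
      clear mono hor
      simp only [IsStep] at s ⊢
      omega
    · have e := s.odd hd
      have v1 := displace_lt mono (u := P i) (v := P (i + 1)) e.1.symm
      have v2 := displace_lt mono (u := P (i + 1)) (v := P i) e.1
      clear mono hor
      simp only [IsStep] at s ⊢
      omega
  disjoint i j hij hj q h1 h2 := by
    obtain ⟨l, u, hl, hu, hlu, hl', hu'⟩ := h.displace_bounds mono hor (by omega) h1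
    obtain ⟨l2, u2, hl2, hu2, hlu2, hl2', hu2'⟩ := h.displace_bounds mono hor hj h2
    have c1 : l2 ≤ u := by
      by_contra hc
      have := mono q.1 u l2 (by omega)
      omega
    have c2 : l ≤ u2 := by
      by_contra hc
      have := mono q.1 u2 l (by omega)
      omega
    exact h.disjoint i j hij hj (q.1, max l l2)
      (mem_segSet_of_between hl hu (le_max_left _ _) (max_le hlu c1))
      (mem_segSet_of_between hl2 hu2 (le_max_right _ _) (max_le c2 hlu2))

end Displace

open Classical in
/-- Shifting upwards a set that is closed upwards and along horizontal segments. -/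
theorem shift (h : IsRealization n D P) {W : Set (ℤ × ℤ)}
    (up : ∀ x y y', (x, y) ∈ W → y ≤ y' → (x, y') ∈ W)
    (hor : ∀ i ≤ n, D i % 2 = 0 → ∀ q q', q ∈ segSet (P i) (P (i + 1)) →
      q' ∈ segSet (P i) (P (i + 1)) → q ∈ W → q' ∈ W) {k : ℤ} (hk : 0 ≤ k) :
    IsRealization n D (fun i => ((P i).1, (P i).2 + if P i ∈ W then k else 0)) := by
  refine h.displace (g := fun q => if q ∈ W then k else 0) ?_ ?_
  · intro x y y' hy
    by_cases h1 : (x, y) ∈ W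
    · have := up x y y' h1 hy.le
      simp only [h1, this, if_true]; omega
    · simp only [h1, if_false]; split_ifs <;> omega
  · intro i hi hd q q' hq hq'
    have : q ∈ W ↔ q' ∈ W := ⟨hor i hi hd q q' hq hq', hor i hi hd q' q hq' hq⟩
    simp only [this]

end IsRealization

end TurnChain

namespace TurnChain

variable {n : ℕ} {D D' : ℕ → ℤ} {P : ℕ → ℤ × ℤ}

theorem IsTurnWord.add_const (hD : IsTurnWord n D) (c : ℤ) : IsTurnWord n (fun i => D i + c) := by
  intro i hi
  have := hD i hi
  simp only
  omega

theorem IsTurnWord.neg (hD : IsTurnWord n D) : IsTurnWord n (fun i => - D i) := by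
  intro i hi
  have := hD i hi
  simp only
  omega

theorem IsTurnWord.one_sub (hD : IsTurnWord n D) : IsTurnWord n (fun i => 1 - D i) := by
  intro i hi
  have := hD i hi
  simp only
  omega

theorem IsRealization.congr (h : IsRealization n D P) (hD : ∀ i ≤ n, D' i % 4 = D i % 4) :
    IsRealization n D' P where
  isStep i hi := by
    have s := h.isStep i hi
    have := hD i hi
    simp only [IsStep] at s ⊢
    omega
  disjoint := h.disjoint

theorem reach_congr (hD : ∀ i ≤ n, D' i % 4 = D i % 4) : Reach n D' = Reach n D := by
  ext q
  exact ⟨fun ⟨P, h, e⟩ => ⟨P, h.congr fun i hi => (hD i hi).symm, e⟩,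
    fun ⟨P, h, e⟩ => ⟨P, h.congr hD, e⟩⟩

theorem reach_rot_of_reach {x y : ℤ} (h : (x, y) ∈ Reach n D) :
    (-y, x) ∈ Reach n (fun i => D i + 1) := by
  obtain ⟨P, hP, e1, e2⟩ := h
  refine ⟨_, hP.rot, ?_, ?_⟩ <;> simp only <;> simp only at e1 e2 <;> omega

theorem reach_rot {x y : ℤ} : (x, y) ∈ Reach n (fun i => D i + 1) ↔ (y, -x) ∈ Reach n D := by
  constructor
  · intro h
    have h2 := reach_rot_of_reach (reach_rot_of_reach (reach_rot_of_reach h))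
    rw [neg_neg] at h2
    rwa [reach_congr (D' := fun i => D i + 1 + 1 + 1 + 1) (D := D) fun i _ => by omega] at h2
  · intro h
    simpa using reach_rot_of_reach h

theorem reach_refl_of_reach {x y : ℤ} (h : (x, y) ∈ Reach n D) :
    (x, -y) ∈ Reach n (fun i => - D i) := by
  obtain ⟨P, hP, e1, e2⟩ := h
  refine ⟨_, hP.refl, ?_, ?_⟩ <;> simp only <;> simp only at e1 e2 <;> omega

theorem reach_refl {x y : ℤ} : (x, y) ∈ Reach n (fun i => - D i) ↔ (x, -y) ∈ Reach n D :=
  ⟨fun h => by simpa using reach_refl_of_reach h, fun h => by simpa using reach_refl_of_reach h⟩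

theorem reach_swap_of_reach {x y : ℤ} (h : (x, y) ∈ Reach n D) :
    (y, x) ∈ Reach n (fun i => 1 - D i) := by
  obtain ⟨P, hP, e1, e2⟩ := h
  exact ⟨_, hP.swap, e2, e1⟩

theorem reach_swap {x y : ℤ} : (x, y) ∈ Reach n (fun i => 1 - D i) ↔ (y, x) ∈ Reach n D :=
  ⟨fun h => by simpa using reach_swap_of_reach h, reach_swap_of_reach⟩

open Classical in
theorem reach_of_shift (hP : IsRealization n D P) {W : Set (ℤ × ℤ)}
    (up : ∀ x y y', (x, y) ∈ W → y ≤ y' → (x, y') ∈ W)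
    (hor : ∀ i ≤ n, D i % 2 = 0 → ∀ q q', q ∈ segSet (P i) (P (i + 1)) →
      q' ∈ segSet (P i) (P (i + 1)) → q ∈ W → q' ∈ W)
    {a b k : ℤ} (hk : 0 ≤ k) (e1 : (P (n + 1)).1 = (P 0).1 + a) (e2 : (P (n + 1)).2 = (P 0).2 + b)
    (h0 : P 0 ∉ W) (h1 : P (n + 1) ∈ W) : (a, b + k) ∈ Reach n D := by
  refine ⟨_, hP.shift up hor hk, ?_, ?_⟩
  · simpa using e1
  · simp only [h0, h1, if_true, if_false]
    omega

open Classical in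
theorem reach_of_shift_start (hP : IsRealization n D P) {W : Set (ℤ × ℤ)}
    (up : ∀ x y y', (x, y) ∈ W → y ≤ y' → (x, y') ∈ W)
    (hor : ∀ i ≤ n, D i % 2 = 0 → ∀ q q', q ∈ segSet (P i) (P (i + 1)) →
      q' ∈ segSet (P i) (P (i + 1)) → q ∈ W → q' ∈ W)
    {a b k : ℤ} (hk : 0 ≤ k) (e1 : (P (n + 1)).1 = (P 0).1 + a) (e2 : (P (n + 1)).2 = (P 0).2 + b)
    (h0 : P 0 ∈ W) (h1 : P (n + 1) ∉ W) : (a, b - k) ∈ Reach n D := by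
  refine ⟨_, hP.shift up hor hk, ?_, ?_⟩
  · simpa using e1
  · simp only [h0, h1, if_true, if_false]
    omega

theorem reach_up_of_axis (hn : 1 ≤ n) (hD : IsTurnWord n D) {a j : ℤ} (h : (a, 0) ∈ Reach n D)
    (hj : 0 ≤ j) : (a, j) ∈ Reach n D := by
  obtain ⟨P, hP, e1, e2⟩ := h
  simp only at e1 e2
  rw [← zero_add j]
  refine reach_of_shift hP
    (W := {q | (P 0).2 < q.2 ∨ (P 0).2 = q.2 ∧ q ∈ segSet (P n) (P (n + 1))})
    ?_ ?_ hj e1 e2 ?_ ?_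
  · rintro x y y' h hy
    rcases hy.eq_or_lt with rfl | hy
    · exact h
    · left; rcases h with h | h <;> simp only at h ⊢ <;> omega
  · rintro i hi hd q q' hq hq' hW
    have hs := (hP.isStep i hi).even hd
    have hqq : q'.2 = q.2 := by simp only [mem_segSet] at hq hq'; omega
    rcases hW with hW | ⟨hW, hq2⟩
    · left; omega
    · right
      refine ⟨by omega, ?_⟩
      by_cases hin : i = n
      · subst hin; exact hq'
      · exfalso
        rcases hP.corner hD hi le_rfl hin hq hq2 with ⟨rfl, rfl⟩ | ⟨rfl, -⟩
        · have h1 := hD i (by omega)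
          have h2 := (hP.isStep (i + 1) le_rfl).odd (by omega)
          omega
        · omega
  · rintro (h | ⟨-, h⟩)
    · exact lt_irrefl _ h
    · have := hP.eq_of_start_mem hD (Nat.zero_le n) le_rfl h
      omega
  · right; exact ⟨by omega, IsRealization.right_mem n⟩

theorem reach_of_axis (hn : 1 ≤ n) (hD : IsTurnWord n D) {a : ℤ} (h : (a, 0) ∈ Reach n D)
    (j : ℤ) : (a, j) ∈ Reach n D := by
  rcases le_total 0 j with hj | hj
  · exact reach_up_of_axis hn hD h hj
  · have h2 := reach_up_of_axis (j := -j) hn hD.neg (a := a) (reach_refl.2 (by simpa using h))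
      (by omega)
    simpa using reach_refl.1 h2

theorem reach_stretch_up {a b b' : ℤ} (hb : 0 < b) (hb' : b ≤ b') (h : (a, b) ∈ Reach n D) :
    (a, b') ∈ Reach n D := by
  obtain ⟨P, hP, e1, e2⟩ := h
  simp only at e1 e2
  rw [show b' = b + (b' - b) by ring]
  refine reach_of_shift hP (W := {q | (P 0).2 + b ≤ q.2}) ?_ ?_ (by omega) e1 e2 ?_ ?_
  · rintro x y y' h hy
    exact le_trans h hy
  · rintro i hi hd q q' hq hq' hW
    have hs := (hP.isStep i hi).even hd
    simp only [mem_segSet, Set.mem_ofPred_eq] at hq hq' hW ⊢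
    omega
  · simp only [Set.mem_ofPred_eq]; omega
  · simp only [Set.mem_ofPred_eq]; omega

/-- If a point of the positive x-axis is reachable, so is the halfplane beyond it. -/
theorem reach_halfplane (hn : 1 ≤ n) (hD : IsTurnWord n D) {a a' : ℤ} (ha : 0 < a) (haa : a ≤ a')
    (h : (a, 0) ∈ Reach n D) (j : ℤ) : (a', j) ∈ Reach n D := by
  exact reach_swap.1 (reach_stretch_up ha haa (reach_swap.2 (reach_of_axis hn hD h j)))

end TurnChain

namespace TurnChain

/-- The horizontal segments among those numbered `m, …, n` that have to move upwards when the
point `a` is moved upwards. -/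
inductive UpSeg (n : ℕ) (D : ℕ → ℤ) (P : ℕ → ℤ × ℤ) (m : ℕ) (a : ℤ × ℤ) : ℕ → Prop
  | base {i : ℕ} {y : ℤ} : m ≤ i → i ≤ n → D i % 2 = 0 →
      (a.1, y) ∈ segSet (P i) (P (i + 1)) → a.2 ≤ y → UpSeg n D P m a i
  | step {i j : ℕ} {x y y' : ℤ} : UpSeg n D P m a i → m ≤ j → j ≤ n → D j % 2 = 0 →
      (x, y) ∈ segSet (P i) (P (i + 1)) → (x, y') ∈ segSet (P j) (P (j + 1)) → y < y' →
      UpSeg n D P m a j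

/-- The region that has to move upwards when the point `a` is moved upwards. -/
def UpSet (n : ℕ) (D : ℕ → ℤ) (P : ℕ → ℤ × ℤ) (m : ℕ) (a : ℤ × ℤ) : Set (ℤ × ℤ) :=
  {q | (q.1 = a.1 ∧ a.2 ≤ q.2) ∨
    ∃ i y, UpSeg n D P m a i ∧ (q.1, y) ∈ segSet (P i) (P (i + 1)) ∧ y ≤ q.2}

variable {n m : ℕ} {D : ℕ → ℤ} {P : ℕ → ℤ × ℤ} {a b : ℤ × ℤ}

theorem UpSeg.bounds {i : ℕ} (hi : UpSeg n D P m a i) : m ≤ i ∧ i ≤ n ∧ D i % 2 = 0 := by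
  cases hi with
  | base h1 h2 h3 => exact ⟨h1, h2, h3⟩
  | step _ h1 h2 h3 => exact ⟨h1, h2, h3⟩

theorem UpSeg.le (h : IsRealization n D P) {i : ℕ} (hi : UpSeg n D P m a i) :
    a.2 ≤ (P i).2 ∧ (a.2 < (P i).2 ∨ a ∈ segSet (P i) (P (i + 1))) := by
  induction hi with
  | @base i y h1 h2 h3 h4 h5 =>
    have s := (h.isStep i h2).even h3
    simp only [mem_segSet] at h4 ⊢
    omega
  | @step i j x y y' hi h1 h2 h3 h4 h5 h6 ih =>
    have b := hi.bounds
    have s := (h.isStep i b.2.1).even b.2.2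
    have s' := (h.isStep j h2).even h3
    have ih := ih.1
    simp only [mem_segSet] at h4 h5
    omega

theorem upSet_up (x y y' : ℤ) (h : (x, y) ∈ UpSet n D P m a) (hy : y ≤ y') :
    (x, y') ∈ UpSet n D P m a := by
  rcases h with h | ⟨i, z, hi, hz, hzy⟩
  · left; simp only at h ⊢; omega
  · right; exact ⟨i, z, hi, hz, hzy.trans hy⟩

theorem upSet_hor (h : IsRealization n D P) (hD : IsTurnWord n D) (j : ℕ) (hmj : m ≤ j)
    (hj : j ≤ n) (hd : D j % 2 = 0) (q q' : ℤ × ℤ) (hq : q ∈ segSet (P j) (P (j + 1)))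
    (hq' : q' ∈ segSet (P j) (P (j + 1))) (hW : q ∈ UpSet n D P m a) :
    q' ∈ UpSet n D P m a := by
  suffices hs : UpSeg n D P m a j from Or.inr ⟨j, q'.2, hs, hq', le_rfl⟩
  rcases hW with ⟨h1, h2⟩ | ⟨i, z, hi, hz, hzq⟩
  · exact UpSeg.base (y := q.2) hmj hj hd (h1 ▸ hq) h2
  · rcases hzq.eq_or_lt with rfl | hlt
    · have b := hi.bounds
      obtain rfl := h.eq_of_mem_of_even hD b.2.1 hj (by omega) hz hq
      exact hi
    · exact UpSeg.step hi hmj hj hd hz hq hlt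

theorem IsRealization.mem_seg_of_even (h : IsRealization n D P) {i : ℕ} (hi : i ≤ n)
    (hd : D i % 2 = 0) (q : ℤ × ℤ) : q ∈ segSet (P i) (P (i + 1)) ↔
      min (P i).1 (P (i + 1)).1 ≤ q.1 ∧ q.1 ≤ max (P i).1 (P (i + 1)).1 ∧ q.2 = (P i).2 := by
  have s := (h.isStep i hi).even hd
  simp only [mem_segSet]
  omega

theorem IsRealization.mem_seg_of_odd (h : IsRealization n D P) {i : ℕ} (hi : i ≤ n)
    (hd : D i % 2 = 1) (q : ℤ × ℤ) : q ∈ segSet (P i) (P (i + 1)) ↔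
      min (P i).2 (P (i + 1)).2 ≤ q.2 ∧ q.2 ≤ max (P i).2 (P (i + 1)).2 ∧ q.1 = (P i).1 := by
  have s := (h.isStep i hi).odd hd
  simp only [mem_segSet]
  omega

theorem swap_mem_segSet {u v q : ℤ × ℤ} : q ∈ segSet u.swap v.swap ↔ q.swap ∈ segSet u v := by
  simp only [mem_segSet, Prod.fst_swap, Prod.snd_swap]
  omega

/-- A horizontal and a vertical segment can only meet at an endpoint of both. -/
theorem IsRealization.corner_cases (h : IsRealization n D P) (hD : IsTurnWord n D) {i j : ℕ}
    (hi : i ≤ n) (hj : j ≤ n) (di : D i % 2 = 0) (dj : D j % 2 = 1)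
    (hx : min (P i).1 (P (i + 1)).1 ≤ (P j).1) (hx' : (P j).1 ≤ max (P i).1 (P (i + 1)).1)
    (hy : min (P j).2 (P (j + 1)).2 ≤ (P i).2) (hy' : (P i).2 ≤ max (P j).2 (P (j + 1)).2) :
    (min (P i).1 (P (i + 1)).1 = (P j).1 ∨ (P j).1 = max (P i).1 (P (i + 1)).1) ∧
    (min (P j).2 (P (j + 1)).2 = (P i).2 ∨ (P i).2 = max (P j).2 (P (j + 1)).2) := by
  have si := (h.isStep i hi).even di
  have sj := (h.isStep j hj).odd dj
  have hij : i ≠ j := by rintro rfl; omega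
  have h1 : ((P j).1, (P i).2) ∈ segSet (P i) (P (i + 1)) := by
    simp only [mem_segSet]; omega
  have h2 : ((P j).1, (P i).2) ∈ segSet (P j) (P (j + 1)) := by
    simp only [mem_segSet]; omega
  rcases h.corner hD hi hj hij h1 h2 with ⟨rfl, hq⟩ | ⟨rfl, hq⟩
  · have e1 := congrArg Prod.fst hq
    have e2 := congrArg Prod.snd hq
    simp only at e1 e2
    omega
  · have e1 := congrArg Prod.fst hq
    have e2 := congrArg Prod.snd hq
    simp only at e1 e2
    omega

/-- The segments moving upwards and the segments moving to the right do not cross. -/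
theorem upSeg_rightSeg (h : IsRealization n D P) (hD : IsTurnWord n D) (hab : a.1 ≤ b.1)
    (hba : b.2 ≤ a.2)
    (h1 : b.2 < a.2 ∨ ∀ i, m ≤ i → i ≤ n → D i % 2 = 0 → a ∈ segSet (P i) (P (i + 1)) →
      max (P i).1 (P (i + 1)).1 ≤ a.1)
    (h2 : a.1 < b.1 ∨ ∀ j, m ≤ j → j ≤ n → D j % 2 = 1 → b ∈ segSet (P j) (P (j + 1)) →
      max (P j).2 (P (j + 1)).2 ≤ b.2) {i j : ℕ} (hi : UpSeg n D P m a i)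
    (hj : UpSeg n (fun i => 1 - D i) (fun i => (P i).swap) m b.swap j) :
    max (P i).1 (P (i + 1)).1 < (P j).1 ∨ max (P j).2 (P (j + 1)).2 < (P i).2 ∨
      (max (P i).1 (P (i + 1)).1 = (P j).1 ∧ max (P j).2 (P (j + 1)).2 = (P i).2) := by
  induction hi generalizing j with
  | @base i y hi1 hi2 hi3 hi4 hi5 =>
    have si := (h.isStep i hi2).even hi3
    induction hj with
    | @base j x hj1 hj2 hj3 hj4 hj5 =>
      have sj := (h.isStep j hj2).odd (by omega)
      by_contra hc
      have hj4' : (x, b.2) ∈ segSet (P j) (P (j + 1)) := by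
        simp only [mem_segSet, Prod.fst_swap, Prod.snd_swap] at hj4 ⊢
        omega
      have ni : min (P i).1 (P (i + 1)).1 < max (P i).1 (P (i + 1)).1 := by clear hc hi4; omega
      have nj : min (P j).2 (P (j + 1)).2 < max (P j).2 (P (j + 1)).2 := by clear hc hj4; omega
      simp only [Prod.snd_swap] at hj5
      have A := h1.imp_right fun h1 => h1 i hi1 hi2 hi3
      have B := h2.imp_right fun h2 => h2 j hj1 hj2 (by omega)
      rw [h.mem_seg_of_even hi2 hi3] at hi4 A
      rw [h.mem_seg_of_odd hj2 (by omega)] at hj4' B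
      have hc' := h.corner_cases hD (i := i) (j := j) hi2 hj2 hi3 (by omega)
      clear h1 h2 si sj hj4
      simp only at hi4 hj4'
      generalize min (P i).1 (P (i + 1)).1 = x1 at *
      generalize max (P i).1 (P (i + 1)).1 = x2 at *
      generalize min (P j).2 (P (j + 1)).2 = y1 at *
      generalize max (P j).2 (P (j + 1)).2 = y2 at *
      have c : (P j).1 ≤ x2 ∧ (P i).2 ≤ y2 := by clear A B hc'; omega
      obtain ⟨q1, q2⟩ := hc' (by clear A B hc' hc; omega) c.1
        (by clear A B hc' hc; omega) c.2
      clear hc'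
      rcases q1 with q1 | q1 <;> rcases q2 with q2 | q2 <;> omega
    | @step j' j x0 x x' hj' hj1 hj2 hj3 hj4 hj5 hj6 ih =>
      have b' := hj'.bounds
      have hl := (hj'.le h.swap).1
      replace hj4 := swap_mem_segSet.1 hj4
      replace hj5 := swap_mem_segSet.1 hj5
      rw [h.mem_seg_of_even hi2 hi3] at hi4
      rw [h.mem_seg_of_odd b'.2.1 (by omega)] at hj4
      rw [h.mem_seg_of_odd hj2 (by omega)] at hj5
      have hc' := h.corner_cases hD (i := i) (j := j) hi2 hj2 hi3 (by omega)
      simp only [Prod.fst_swap, Prod.snd_swap] at hi4 hj4 hj5 hl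
      clear h1 h2 si
      by_contra hc
      generalize min (P i).1 (P (i + 1)).1 = x1 at *
      generalize max (P i).1 (P (i + 1)).1 = x2 at *
      generalize min (P j).2 (P (j + 1)).2 = y1 at *
      generalize max (P j).2 (P (j + 1)).2 = y2 at *
      have c : (P j).1 ≤ x2 ∧ (P i).2 ≤ y2 := by clear hc' ih; omega
      obtain ⟨q1, q2⟩ := hc' (by omega) c.1 (by omega) c.2
      omega
  | @step i' i x0 y y' hi' hi1 hi2 hi3 hi4 hi5 hi6 ihi =>
    have bi' := hi'.bounds
    have hli := (hi'.le h).1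
    rw [h.mem_seg_of_even bi'.2.1 (by omega)] at hi4
    rw [h.mem_seg_of_even hi2 hi3] at hi5
    simp only at hi4 hi5
    induction hj with
    | @base j x hj1 hj2 hj3 hj4 hj5 =>
      have ih := ihi (UpSeg.base hj1 hj2 hj3 hj4 hj5)
      replace hj4 := swap_mem_segSet.1 hj4
      rw [h.mem_seg_of_odd hj2 (by omega)] at hj4
      have hc' := h.corner_cases hD (i := i) (j := j) hi2 hj2 hi3 (by omega)
      simp only [Prod.fst_swap, Prod.snd_swap] at hj4 hj5
      clear h1 h2 ihi
      by_contra hc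
      generalize min (P i).1 (P (i + 1)).1 = x1 at *
      generalize max (P i).1 (P (i + 1)).1 = x2 at *
      generalize min (P j).2 (P (j + 1)).2 = y1 at *
      generalize max (P j).2 (P (j + 1)).2 = y2 at *
      have c : (P j).1 ≤ x2 ∧ (P i).2 ≤ y2 := by clear hc' ih; omega
      obtain ⟨q1, q2⟩ := hc' (by omega) c.1 (by omega) c.2
      omega
    | @step j' j y0 x x' hj' hj1 hj2 hj3 hj4 hj5 hj6 ihj =>
      have b' := hj'.bounds
      have ih := ihi (UpSeg.step hj' hj1 hj2 hj3 hj4 hj5 hj6)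
      replace hj4 := swap_mem_segSet.1 hj4
      replace hj5 := swap_mem_segSet.1 hj5
      rw [h.mem_seg_of_odd b'.2.1 (by omega)] at hj4
      rw [h.mem_seg_of_odd hj2 (by omega)] at hj5
      have hc' := h.corner_cases hD (i := i) (j := j) hi2 hj2 hi3 (by omega)
      simp only [Prod.fst_swap, Prod.snd_swap] at hj4 hj5
      clear h1 h2 ihi
      by_contra hc
      generalize min (P i).1 (P (i + 1)).1 = x1 at *
      generalize max (P i).1 (P (i + 1)).1 = x2 at *
      generalize min (P j).2 (P (j + 1)).2 = y1 at *
      generalize max (P j).2 (P (j + 1)).2 = y2 at *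
      have c : (P j).1 ≤ x2 ∧ (P i).2 ≤ y2 := by clear hc' ih ihj; omega
      have c1 : x1 < (P j).1 := by clear hc' ihj; omega
      have c2 : y1 < (P i).2 := by clear hc' ih; omega
      obtain ⟨q1, q2⟩ := hc' c1.le c.1 c2.le c.2
      clear ih ihj
      omega

theorem not_mem_upSet_rightSet (h : IsRealization n D P) (hD : IsTurnWord n D) (hab : a.1 ≤ b.1)
    (hba : b.2 ≤ a.2)
    (h1 : b.2 < a.2 ∨ ∀ i, m ≤ i → i ≤ n → D i % 2 = 0 → a ∈ segSet (P i) (P (i + 1)) →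
      max (P i).1 (P (i + 1)).1 ≤ a.1)
    (h2 : a.1 < b.1 ∨ ∀ j, m ≤ j → j ≤ n → D j % 2 = 1 → b ∈ segSet (P j) (P (j + 1)) →
      max (P j).2 (P (j + 1)).2 ≤ b.2)
    (h3 : a ≠ b ∨ P (n + 1) ≠ a)
    (hU : P (n + 1) ∈ UpSet n D P m a)
    (hR : (P (n + 1)).swap ∈ UpSet n (fun i => 1 - D i) (fun i => (P i).swap) m b.swap) :
    False := by
  have h3' : ¬ (a.1 = b.1 ∧ a.2 = b.2 ∧ (P (n + 1)).1 = a.1 ∧ (P (n + 1)).2 = a.2) := by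
    rintro ⟨e1, e2, e3, e4⟩
    exact h3.elim (fun h => h (Prod.ext e1 e2)) (fun h => h (Prod.ext e3 e4))
  rcases hU with hU | ⟨i, y, hi, hy, hye⟩ <;> rcases hR with hR | ⟨j, x, hj, hx, hxe⟩
  · simp only [Prod.fst_swap, Prod.snd_swap] at hR
    omega
  · have bj := hj.bounds
    have sj := (h.isStep j bj.2.1).odd (by omega)
    have hl := hj.le h.swap
    have B := h2.imp_right fun h2 => h2 j bj.1 bj.2.1 (by omega)
    simp only [mem_segSet, Prod.fst_swap, Prod.snd_swap] at hx hxe hl B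
    omega
  · have bi := hi.bounds
    have si := (h.isStep i bi.2.1).even (by omega)
    have hl := hi.le h
    have A := h1.imp_right fun h1 => h1 i bi.1 bi.2.1 (by omega)
    simp only [mem_segSet, Prod.fst_swap, Prod.snd_swap] at hy hR hl A
    omega
  · have bi := hi.bounds
    have si := (h.isStep i bi.2.1).even (by omega)
    have bj := hj.bounds
    have sj := (h.isStep j bj.2.1).odd (by omega)
    have K := upSeg_rightSeg h hD hab hba h1 h2 hi hj
    simp only [mem_segSet, Prod.fst_swap, Prod.snd_swap] at hx hxe hy hye
    have m1 : P (n + 1) ∈ segSet (P i) (P (i + 1)) := by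
      simp only [mem_segSet]; omega
    have m2 : P (n + 1) ∈ segSet (P j) (P (j + 1)) := by
      simp only [mem_segSet]; omega
    have e1 := h.eq_of_last_mem hD bi.2.1 m1
    have e2 := h.eq_of_last_mem hD bj.2.1 m2
    subst e1 e2
    omega

end TurnChain

namespace TurnChain

variable {n m : ℕ} {D : ℕ → ℤ} {P : ℕ → ℤ × ℤ} {a b : ℤ × ℤ}

theorem last_ne_start (h : IsRealization n D P) (hD : IsTurnWord n D) (hm : m ≤ n) :
    P (n + 1) ≠ P m := by
  intro e
  have h1 : P (n + 1) ∈ segSet (P m) (P (m + 1)) := by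
    rw [e]; exact IsRealization.left_mem m
  obtain rfl := h.eq_of_last_mem hD hm h1
  have s := h.isStep m hm
  simp only [IsStep, e] at s
  omega

/-- If moving the start of a subchain upwards and moving it to the right both force the endpoint
to move, then the subchain does not start westwards. -/
theorem not_west_of_mem_upSet (h : IsRealization n D P) (hD : IsTurnWord n D) (hm : m ≤ n)
    (hd : D m % 4 = 2) (hU : P (n + 1) ∈ UpSet n D P m (P m))
    (hR : (P (n + 1)).swap ∈ UpSet n (fun i => 1 - D i) (fun i => (P i).swap) m (P m).swap) :
    False := by
  refine not_mem_upSet_rightSet h hD le_rfl le_rfl (Or.inr ?_) (Or.inr ?_)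
    (Or.inr (last_ne_start h hD hm)) hU hR
  · intro i hmi hi hdi hmem
    obtain rfl := h.eq_of_start_mem hD hmi hi hmem
    have s := h.isStep i hi
    simp only [IsStep] at s
    omega
  · intro i hmi hi hdi hmem
    obtain rfl := h.eq_of_start_mem hD hmi hi hmem
    omega

/-- After an eastward first segment, moving the start to the right forces the next vertex to
move. -/
theorem rightSet_succ (h : IsRealization n D P) (hD : IsTurnWord n D) (hm : m < n)
    (hd : D m % 4 = 0)
    (hR : (P (n + 1)).swap ∈ UpSet n (fun i => 1 - D i) (fun i => (P i).swap) m (P m).swap) :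
    (P (n + 1)).swap ∈
      UpSet n (fun i => 1 - D i) (fun i => (P i).swap) (m + 1) (P (m + 1)).swap := by
  have s : (P (m + 1)).2 = (P m).2 ∧ (P m).1 < (P (m + 1)).1 := by
    have := h.isStep m hm.le
    simp only [IsStep] at this
    omega
  have hmem : ∀ q : ℤ × ℤ, q ∈ segSet (P m) (P (m + 1)) ↔
      (P m).1 ≤ q.1 ∧ q.1 ≤ (P (m + 1)).1 ∧ q.2 = (P m).2 := by
    intro q
    simp only [mem_segSet]
    omega
  have hseg : ∀ j, UpSeg n (fun i => 1 - D i) (fun i => (P i).swap) m (P m).swap j →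
      UpSeg n (fun i => 1 - D i) (fun i => (P i).swap) (m + 1) (P (m + 1)).swap j := by
    intro j hj
    induction hj with
    | @base j x h1 h2 h3 h4 h5 =>
      have hmj : m + 1 ≤ j := by
        rcases h1.eq_or_lt with rfl | h1 <;> omega
      refine UpSeg.base (y := x) hmj h2 h3 ?_ ?_
      · simp only [Prod.fst_swap] at h4 ⊢
        rw [s.1]
        exact h4
      · simp only [Prod.snd_swap] at h5 ⊢
        by_contra hc
        have h4' := swap_mem_segSet.1 h4
        have := h.corner hD hm.le h2 (by omega)
          ((hmem ((P m).swap.1, x).swap).2 ⟨h5, (not_le.1 hc).le, rfl⟩) h4'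
        rcases this with ⟨-, hq⟩ | ⟨hq, -⟩
        · have := congrArg Prod.fst hq
          simp only [Prod.fst_swap] at this
          omega
        · omega
    | @step i j x y y' hi h1 h2 h3 h4 h5 h6 ih =>
      refine UpSeg.step ih ?_ h2 h3 h4 h5 h6
      rcases h1.eq_or_lt with rfl | h1 <;> omega
  rcases hR with ⟨h1, h2⟩ | ⟨j, x, hj, hx⟩
  · left
    simp only [Prod.fst_swap, Prod.snd_swap] at h1 h2 ⊢
    refine ⟨by omega, ?_⟩
    by_contra hc
    have := h.eq_of_last_mem hD hm.le ((hmem _).2 (by omega))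
    omega
  · right
    exact ⟨j, x, hseg j hj, hx⟩

/-- After an eastward first segment, moving the start upwards amounts to moving some point of
that segment upwards. -/
theorem exists_mem_upSet_succ (h : IsRealization n D P) (hm : m < n)
    (hd : D m % 4 = 0) (hU : P (n + 1) ∈ UpSet n D P m (P m)) :
    ∃ x, (P m).1 ≤ x ∧ x ≤ (P (m + 1)).1 ∧ P (n + 1) ∈ UpSet n D P (m + 1) (x, (P m).2) := by
  have s : (P (m + 1)).2 = (P m).2 ∧ (P m).1 < (P (m + 1)).1 := by
    have := h.isStep m hm.le
    simp only [IsStep] at this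
    omega
  have hseg : ∀ i, UpSeg n D P m (P m) i → i = m ∨
      ∃ x, (P m).1 ≤ x ∧ x ≤ (P (m + 1)).1 ∧ UpSeg n D P (m + 1) (x, (P m).2) i := by
    intro i hi
    induction hi with
    | @base i y h1 h2 h3 h4 h5 =>
      rcases h1.eq_or_lt with rfl | h1
      · exact Or.inl rfl
      · exact Or.inr ⟨_, le_rfl, s.2.le, UpSeg.base h1 h2 h3 h4 h5⟩
    | @step i j x y y' hi h1 h2 h3 h4 h5 h6 ih =>
      rcases h1.eq_or_lt with rfl | h1
      · exact Or.inl rfl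
      · right
        rcases ih with rfl | ⟨x', hx, hx', ih⟩
        · simp only [mem_segSet] at h4
          exact ⟨x, by omega, by omega, UpSeg.base (y := y') h1 h2 h3 h5 (by simp only; omega)⟩
        · exact ⟨x', hx, hx', UpSeg.step ih h1 h2 h3 h4 h5 h6⟩
  rcases hU with hU | ⟨i, y, hi, hy, hye⟩
  · exact ⟨_, le_rfl, s.2.le, Or.inl hU⟩
  · rcases hseg i hi with rfl | ⟨x, hx, hx', hi⟩
    · simp only [mem_segSet] at hy
      exact ⟨(P (n + 1)).1, by omega, by omega, Or.inl ⟨rfl, by simp only; omega⟩⟩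
    · exact ⟨x, hx, hx', Or.inr ⟨i, y, hi, hy, hye⟩⟩

theorem mem_upSet_succ (h : IsRealization n D P) (hD : IsTurnWord n D) (hm : m < n)
    (hd : D m % 4 = 0) (hU : P (n + 1) ∈ UpSet n D P m (P m))
    (hR : (P (n + 1)).swap ∈ UpSet n (fun i => 1 - D i) (fun i => (P i).swap) m (P m).swap) :
    P (n + 1) ∈ UpSet n D P (m + 1) (P (m + 1)) ∧ (P (n + 1)).swap ∈
      UpSet n (fun i => 1 - D i) (fun i => (P i).swap) (m + 1) (P (m + 1)).swap := by
  have s : (P (m + 1)).2 = (P m).2 ∧ (P m).1 < (P (m + 1)).1 := by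
    have := h.isStep m hm.le
    simp only [IsStep] at this
    omega
  have hR' := rightSet_succ h hD hm hd hR
  refine ⟨?_, hR'⟩
  obtain ⟨x, hx, hx', hU'⟩ := exists_mem_upSet_succ h hm hd hU
  rcases hx'.eq_or_lt with rfl | hlt
  · rwa [← s.1] at hU'
  · exfalso
    refine not_mem_upSet_rightSet (a := (x, (P m).2)) h hD hx' s.1.le (Or.inr ?_) (Or.inl hlt) (Or.inl ?_) hU' hR'
    · intro i hmi hi hdi hmem
      have := h.eq_of_mem_of_even hD (i := m) (j := i) hm.le hi (by omega)
        (q := (x, (P m).2)) (by simp only [mem_segSet]; omega) hmem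
      omega
    · intro e
      have := congrArg Prod.fst e
      simp only at this
      omega

theorem staircase_of_mem_upSet (h : IsRealization n D P) (hD : IsTurnWord n D) (hm : m ≤ n)
    (hU : P (n + 1) ∈ UpSet n D P m (P m))
    (hR : (P (n + 1)).swap ∈ UpSet n (fun i => 1 - D i) (fun i => (P i).swap) m (P m).swap) :
    ∀ i, m ≤ i → i ≤ n → D i % 4 = 0 ∨ D i % 4 = 1 := by
  have hU' : (P (n + 1)).swap.swap ∈ UpSet n (fun i => 1 - (1 - D i))
      (fun i => (P i).swap.swap) m (P m).swap.swap := by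
    simpa only [sub_sub_cancel, Prod.swap_swap] using hU
  induction hk : n - m generalizing m with
  | zero =>
    have c1 : D m % 4 ≠ 2 := fun hd => not_west_of_mem_upSet h hD hm hd hU hR
    have c2 : D m % 4 ≠ 3 := fun hd =>
      not_west_of_mem_upSet h.swap hD.one_sub hm (by omega) hR hU'
    intro i h1 h2
    obtain rfl : i = m := by omega
    omega
  | succ k ih =>
    have c1 : D m % 4 ≠ 2 := fun hd => not_west_of_mem_upSet h hD hm hd hU hR
    have c2 : D m % 4 ≠ 3 := fun hd =>
      not_west_of_mem_upSet h.swap hD.one_sub hm (by omega) hR hU'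
    have hmn : m < n := by omega
    have key : D m % 4 = 0 ∨ D m % 4 = 1 := by omega
    have next : P (n + 1) ∈ UpSet n D P (m + 1) (P (m + 1)) ∧ (P (n + 1)).swap ∈
        UpSet n (fun i => 1 - D i) (fun i => (P i).swap) (m + 1) (P (m + 1)).swap := by
      rcases key with hd | hd
      · exact mem_upSet_succ h hD hmn hd hU hR
      · have := mem_upSet_succ h.swap hD.one_sub hmn (by omega) hR hU'
        refine ⟨?_, this.1⟩
        simpa only [sub_sub_cancel, Prod.swap_swap] using this.2
    have rest := ih hmn next.1 next.2 (by
      simpa only [sub_sub_cancel, Prod.swap_swap] using next.1) (by omega)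
    intro i h1 h2
    rcases h1.eq_or_lt with rfl | h1
    · exact key
    · exact rest i h1 h2

/-- A point of the open northeast quadrant can be moved onto an axis, unless the chain is a
staircase. -/
theorem reach_axis_of_reach (hD : IsTurnWord n D) (hH : ∃ k, k + 2 ≤ n ∧ D (k + 2) ≠ D k)
    {x y : ℤ} (hx : 0 < x) (hy : 0 < y) (h : (x, y) ∈ Reach n D) :
    (x, 0) ∈ Reach n D ∨ (0, y) ∈ Reach n D := by
  obtain ⟨P, hP, e1, e2⟩ := h
  simp only at e1 e2
  by_cases hU : P (n + 1) ∈ UpSet n D P 0 (P 0)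
  · by_cases hR : (P (n + 1)).swap ∈
        UpSet n (fun i => 1 - D i) (fun i => (P i).swap) 0 (P 0).swap
    · exfalso
      have hs := staircase_of_mem_upSet hP hD (Nat.zero_le n) hU hR
      obtain ⟨k, hk, hne⟩ := hH
      have t1 := hD k (by omega)
      have t2 : D (k + 2) = D (k + 1) + 1 ∨ D (k + 2) = D (k + 1) - 1 := hD (k + 1) (by omega)
      have h0 := hs k (by omega) (by omega)
      have h1 := hs (k + 1) (by omega) (by omega)
      have h2 := hs (k + 2) (by omega) (by omega)
      omega
    · right
      have := reach_of_shift_start hP.swap upSet_up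
        (fun i hi => upSet_hor hP.swap hD.one_sub i (Nat.zero_le i) hi) (a := y) (b := x) hx.le
        e2 e1 (Or.inl ⟨rfl, le_rfl⟩) hR
      rw [sub_self] at this
      exact reach_swap.1 this
  · left
    have := reach_of_shift_start hP upSet_up
      (fun i hi => upSet_hor hP hD i (Nat.zero_le i) hi) (a := x) (b := y) hy.le
      e1 e2 (Or.inl ⟨rfl, le_rfl⟩) hU
    rwa [sub_self] at this

end TurnChain

namespace TurnChain

variable {n : ℕ} {D : ℕ → ℤ} {P : ℕ → ℤ × ℤ}

theorem exists_bound (n : ℕ) (P : ℕ → ℤ × ℤ) :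
    ∃ B : ℤ, ∀ i ≤ n, -B < (P i).1 ∧ (P i).1 < B ∧ -B < (P i).2 ∧ (P i).2 < B := by
  induction n with
  | zero =>
    refine ⟨max (P 0).1 (-(P 0).1) + max (P 0).2 (-(P 0).2) + 1, fun i hi => ?_⟩
    obtain rfl : i = 0 := by omega
    omega
  | succ n ih =>
    obtain ⟨B, hB⟩ := ih
    refine ⟨max B (max (P (n + 1)).1 (-(P (n + 1)).1) + max (P (n + 1)).2 (-(P (n + 1)).2) + 1), fun i hi => ?_⟩
    rcases hi.eq_or_lt with rfl | hi
    · omega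
    · have := hB i (by omega)
      omega

/-- Reflection in the y-axis. -/
theorem IsRealization.mirror (h : IsRealization n D P) :
    IsRealization n (fun i => 2 - D i) (fun i => (-(P i).1, (P i).2)) :=
  h.swap.rot.congr fun i _ => by omega

theorem IsTurnWord.two_sub (hD : IsTurnWord n D) : IsTurnWord n (fun i => 2 - D i) := by
  intro i hi
  have := hD i hi
  simp only
  omega

theorem IsTurnWord.mono {k : ℕ} (hD : IsTurnWord n D) (hk : k ≤ n) : IsTurnWord k D :=
  fun i hi => hD i (by omega)

/-- Extending a chain whose last point is its rightmost one by a segment to the south. -/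
theorem IsRealization.extend (h : IsRealization n D P) (h0 : P 0 = 0)
    (hlt : ∀ i ≤ n, (P i).1 < (P (n + 1)).1) (hd : D (n + 1) % 4 = 3) :
    ∃ M₀ : ℤ, ∀ M ≥ M₀, ∃ R, IsRealization (n + 1) D R ∧ R 0 = 0 ∧ (R (n + 2)).2 = -M ∧
      ∀ i ≤ n + 1, -M < (R i).2 := by
  obtain ⟨B, hB⟩ := exists_bound (n + 1) P
  refine ⟨B, fun M hM => ?_⟩
  have hR : ∀ i ≤ n + 1, (fun i => if i ≤ n + 1 then P i else ((P (n + 1)).1, -M)) i = P i :=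
    fun i hi => if_pos hi
  have hR' : (fun i => if i ≤ n + 1 then P i else ((P (n + 1)).1, -M)) (n + 2) =
      ((P (n + 1)).1, -M) := if_neg (by omega)
  generalize (fun i => if i ≤ n + 1 then P i else ((P (n + 1)).1, -M)) = R at hR hR'
  refine ⟨R, ⟨?_, ?_⟩, ?_, ?_, ?_⟩
  · intro i hi
    rcases Nat.lt_or_ge n i with hi' | hi'
    · obtain rfl : i = n + 1 := by omega
      rw [hR _ le_rfl, hR']
      have := hB (n + 1) le_rfl
      simp only [IsStep, true_and]
      omega
    · rw [hR i hi, hR (i + 1) (by omega)]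
      exact h.isStep i hi'
  · intro i j hij hj q hq
    rw [hR i (by omega), hR (i + 1) (by omega)] at hq
    rcases Nat.lt_or_ge n j with hj' | hj'
    · obtain rfl : j = n + 1 := by omega
      rw [hR _ le_rfl, hR']
      have h1 := hlt i (by omega)
      have h2 := hlt (i + 1) (by omega)
      simp only [mem_segSet] at hq ⊢
      omega
    · rw [hR j hj, hR (j + 1) (by omega)]
      exact h.disjoint i j hij hj' q hq
  · rw [hR 0 (by omega), h0]
  · rw [hR']
  · intro i hi
    rw [hR i hi]
    have := hB i hi
    omega

/-- A chain whose last direction is south can be drawn with its last point as low as desired and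
strictly below all other vertices. -/
theorem exists_realization_south (n : ℕ) (D : ℕ → ℤ) (hD : IsTurnWord n D) (hd : D n % 4 = 3) :
    ∃ M₀ : ℤ, ∀ M ≥ M₀, ∃ P, IsRealization n D P ∧ P 0 = 0 ∧ (P (n + 1)).2 = -M ∧
      ∀ i ≤ n, -M < (P i).2 := by
  induction n generalizing D with
  | zero =>
    refine ⟨1, fun M hM => ⟨fun i => (0, -M * i), ⟨?_, ?_⟩, ?_, ?_, ?_⟩⟩
    · intro i hi
      obtain rfl : i = 0 := by omega
      simp [IsStep]
      omega
    · intro i j hij hj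
      omega
    · simp
    · simp
    · intro i hi
      obtain rfl : i = 0 := by omega
      simp
      omega
  | succ n ih =>
    have main : ∀ D : ℕ → ℤ, IsTurnWord (n + 1) D → D (n + 1) % 4 = 3 → D n % 4 = 0 →
        ∃ M₀ : ℤ, ∀ M ≥ M₀, ∃ P, IsRealization (n + 1) D P ∧ P 0 = 0 ∧ (P (n + 2)).2 = -M ∧
          ∀ i ≤ n + 1, -M < (P i).2 := by
      intro D hD hd hd'
      obtain ⟨M₀, h⟩ := ih (fun i => D i + -1) ((hD.mono (by omega)).add_const (-1))
        (by omega)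
      obtain ⟨P, hP, h0, h1, h2⟩ := h M₀ le_rfl
      refine IsRealization.extend (hP.rot.congr (D' := D) fun i _ => by omega)
        ?_ ?_ hd
      · simp [h0]
      · intro i hi
        have := h2 i hi
        simp only
        omega
    have t := hD n (by omega)
    rcases (by omega : D n % 4 = 0 ∨ D n % 4 = 2) with h | h
    · exact main D hD hd h
    · obtain ⟨M₀, h⟩ := main _ hD.two_sub (by omega) (by omega)
      refine ⟨M₀, fun M hM => ?_⟩
      obtain ⟨P, hP, h0, h1, h2⟩ := h M hM
      refine ⟨_, hP.mirror.congr fun i _ => by omega, ?_, h1, h2⟩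
      simp [h0]

/-- Joining two chains ending southwards at the same lowest level by an eastward segment. -/
theorem exists_reach_of_join {k s : ℕ} (hk : D (k + 1) % 4 = 0) {D' : ℕ → ℤ}
    (hD' : ∀ i ≤ s, D' i = D (k + 2 + s - i) + 2) {P Q : ℕ → ℤ × ℤ} {M : ℤ}
    (hP : IsRealization k D P) (hQ : IsRealization s D' Q) (hP0 : P 0 = 0) (hQ0 : Q 0 = 0)
    (hPM : (P (k + 1)).2 = -M) (hQM : (Q (s + 1)).2 = -M)
    (hPl : ∀ i ≤ k, -M < (P i).2) (hQl : ∀ i ≤ s, -M < (Q i).2) :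
    ∃ a : ℤ, 0 < a ∧ (a, 0) ∈ Reach (k + 2 + s) D := by
  obtain ⟨B, hB⟩ := exists_bound (k + 1) P
  obtain ⟨C, hC⟩ := exists_bound (s + 1) Q
  have hB0 := hB 0 (by omega)
  have hC0 := hC 0 (by omega)
  obtain ⟨R, hR, hR'⟩ : ∃ R : ℕ → ℤ × ℤ, (∀ i ≤ k + 1, R i = P i) ∧
      ∀ j ≤ s + 1, R (k + 2 + (s + 1) - j) = ((Q j).1 + (B + C), (Q j).2) := by
    refine ⟨fun i => if i ≤ k + 1 then P i else
      ((Q (k + 2 + (s + 1) - i)).1 + (B + C), (Q (k + 2 + (s + 1) - i)).2),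
      fun i hi => if_pos hi, fun j hj => ?_⟩
    simp only
    rw [if_neg (by omega), show k + 2 + (s + 1) - (k + 2 + (s + 1) - j) = j by omega]
  have hidx : ∀ i, k + 2 ≤ i → i ≤ k + 2 + s → ∃ j ≤ s, i = k + 2 + s - j ∧
      R i = ((Q (j + 1)).1 + (B + C), (Q (j + 1)).2) ∧
      R (i + 1) = ((Q j).1 + (B + C), (Q j).2) := by
    intro i h1 h2
    refine ⟨k + 2 + s - i, by omega, by omega, ?_, ?_⟩
    · rw [← hR' _ (by omega)]; congr 1; omega
    · rw [← hR' _ (by omega)]; congr 1; omega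
  have hmid : R (k + 2) = ((Q (s + 1)).1 + (B + C), (Q (s + 1)).2) := by
    rw [← hR' _ le_rfl]; congr 1; omega
  have hb1 := hB (k + 1) le_rfl
  have hc1 := hC (s + 1) le_rfl
  refine ⟨B + C, by omega, R, ⟨?_, ?_⟩, ?_, ?_⟩
  · intro i hi
    rcases lt_trichotomy i (k + 1) with h | h | h
    · rw [hR i (by omega), hR (i + 1) (by omega)]
      exact hP.isStep i (by omega)
    · subst h
      rw [hR _ le_rfl, hmid]
      simp only [IsStep]
      omega
    · obtain ⟨j, hj, rfl, e1, e2⟩ := hidx i (by omega) hi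
      rw [e1, e2]
      have := hQ.isStep j hj
      rw [hD' j hj] at this
      simp only [IsStep] at this ⊢
      omega
  · intro i j hij hj q hq
    rcases Nat.lt_or_ge i (k + 1) with h | h
    · rw [hR i (by omega), hR (i + 1) (by omega)] at hq
      rcases lt_trichotomy j (k + 1) with h' | rfl | h'
      · rw [hR j (by omega), hR (j + 1) (by omega)]
        exact hP.disjoint i j hij (by omega) q hq
      · rw [hR _ le_rfl, hmid]
        have l1 := hPl i (by omega)
        have l2 := hPl (i + 1) (by omega)
        simp only [mem_segSet] at hq ⊢
        omega
      · obtain ⟨j', hj', rfl, e1, e2⟩ := hidx j (by omega) hj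
        rw [e1, e2]
        have b1 := hB i (by omega)
        have b2 := hB (i + 1) (by omega)
        have c1 := hC j' (by omega)
        have c2 := hC (j' + 1) (by omega)
        simp only [mem_segSet] at hq ⊢
        omega
    · obtain ⟨j', hj', rfl, e1, e2⟩ := hidx j (by omega) hj
      rw [e1, e2]
      rcases h.eq_or_lt with rfl | h
      · rw [hR _ le_rfl, hmid] at hq
        have l1 := hQl j' (by omega)
        have l2 := hQl (j' + 1) (by omega)
        simp only [mem_segSet] at hq ⊢
        omega
      · obtain ⟨i', hi', rfl, e3, e4⟩ := hidx i (by omega) (by omega)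
        rw [e3, e4] at hq
        intro hq'
        refine hQ.disjoint j' i' (by omega) hi' (q.1 - (B + C), q.2) ?_ ?_
        · simp only [mem_segSet] at hq' ⊢; omega
        · simp only [mem_segSet] at hq ⊢; omega
  · have := hR' 0 (by omega)
    rw [hR 0 (by omega), hP0]
    rw [hQ0] at this
    simp only [Nat.sub_zero] at this
    simp [show k + 2 + s + 1 = k + 2 + (s + 1) by omega, this]
  · have := hR' 0 (by omega)
    rw [hR 0 (by omega), hP0]
    rw [hQ0] at this
    simp only [Nat.sub_zero] at this
    simp [show k + 2 + s + 1 = k + 2 + (s + 1) by omega, this]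

theorem exists_reach_of_left_hook (hD : IsTurnWord n D) {k : ℕ} (hk : k + 2 ≤ n)
    (h0 : D k % 4 = 3) (h1 : D (k + 1) % 4 = 0) (h2 : D (k + 2) % 4 = 1) :
    ∃ a : ℤ, 0 < a ∧ (a, 0) ∈ Reach n D := by
  obtain ⟨s, rfl⟩ := Nat.exists_eq_add_of_le hk
  obtain ⟨M₁, H1⟩ := exists_realization_south k D (hD.mono (by omega)) h0
  have hD' : IsTurnWord s (fun i => D (k + 2 + s - i) + 2) := by
    intro i hi
    have := hD (k + 2 + s - (i + 1)) (by omega)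
    rw [show k + 2 + s - (i + 1) + 1 = k + 2 + s - i by omega] at this
    simp only
    omega
  obtain ⟨M₂, H2⟩ := exists_realization_south s _ hD' (by
    simp only [Nat.add_sub_cancel]; omega)
  obtain ⟨P, hP, hP0, hPM, hPl⟩ := H1 (max M₁ M₂) (le_max_left _ _)
  obtain ⟨Q, hQ, hQ0, hQM, hQl⟩ := H2 (max M₁ M₂) (le_max_right _ _)
  exact exists_reach_of_join h1 (fun i _ => rfl) hP hQ hP0 hQ0 hPM hQM hPl hQl

/-- A right hook makes some point of the positive x-axis reachable. -/
theorem exists_reach_of_hook (hD : IsTurnWord n D) (hH : Hook n D 0) :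
    ∃ a : ℤ, 0 < a ∧ (a, 0) ∈ Reach n D := by
  obtain ⟨k, hk, hne, h1⟩ := hH
  have t1 := hD k (by omega)
  have t2 : D (k + 2) = D (k + 1) + 1 ∨ D (k + 2) = D (k + 1) - 1 := hD (k + 1) (by omega)
  rcases (by omega : (D k % 4 = 3 ∧ D (k + 2) % 4 = 1) ∨ (D k % 4 = 1 ∧ D (k + 2) % 4 = 3))
    with h | h
  · exact exists_reach_of_left_hook hD hk h.1 h1 h.2
  · obtain ⟨a, ha, hr⟩ := exists_reach_of_left_hook hD.neg hk (by omega) (by omega) (by omega)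
    exact ⟨a, ha, by simpa using reach_refl.1 hr⟩

end TurnChain

namespace TurnChain

/-- `v` is the neighbour of `u` in direction `d` (in multiples of 90°). -/
def IsUnitStep (d : ℤ) (u v : ℤ × ℤ) : Prop :=
  (d % 4 = 0 ∧ v.1 = u.1 + 1 ∧ v.2 = u.2) ∨ (d % 4 = 1 ∧ v.1 = u.1 ∧ v.2 = u.2 + 1) ∨
  (d % 4 = 2 ∧ v.1 = u.1 - 1 ∧ v.2 = u.2) ∨ (d % 4 = 3 ∧ v.1 = u.1 ∧ v.2 = u.2 - 1)

/-- The number of the open quadrant or half-axis containing the vector from `u` to `v`, counted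
counterclockwise from the positive x-axis. -/
def sector (u v : ℤ × ℤ) : ℤ :=
  if v.2 = u.2 then if u.1 < v.1 then 0 else 4
  else if u.2 < v.2 then if u.1 < v.1 then 1 else if v.1 = u.1 then 2 else 3
  else if v.1 < u.1 then 5 else if v.1 = u.1 then 6 else 7

/-- The difference of two sectors, as the representative in `[-4, 3]` modulo 8. -/
def sectorDiff (s s' : ℤ) : ℤ := (s' - s + 4) % 8 - 4

theorem abs_sectorDiff_right {u v w : ℤ × ℤ} {d : ℤ} (h : IsUnitStep d v w) (hv : v ≠ u)
    (hw : w ≠ u) :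
    -1 ≤ sectorDiff (sector u v) (sector u w) ∧ sectorDiff (sector u v) (sector u w) ≤ 1 := by
  obtain ⟨u1, u2⟩ := u
  obtain ⟨v1, v2⟩ := v
  obtain ⟨w1, w2⟩ := w
  simp only [ne_eq, Prod.mk.injEq] at hv hw
  simp only [IsUnitStep] at h
  simp only [sector, sectorDiff]
  split_ifs <;> omega

theorem abs_sectorDiff_left {u v w : ℤ × ℤ} {d : ℤ} (h : IsUnitStep d v w) (hv : v ≠ u)
    (hw : w ≠ u) :
    -1 ≤ sectorDiff (sector v u) (sector w u) ∧ sectorDiff (sector v u) (sector w u) ≤ 1 := by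
  obtain ⟨u1, u2⟩ := u
  obtain ⟨v1, v2⟩ := v
  obtain ⟨w1, w2⟩ := w
  simp only [ne_eq, Prod.mk.injEq] at hv hw
  simp only [IsUnitStep] at h
  simp only [sector, sectorDiff]
  split_ifs <;> omega

theorem sectorDiff_of_turn {u v w : ℤ × ℤ} {d e : ℤ} (h : IsUnitStep d u v) (h' : IsUnitStep e v w)
    (hde : e ≤ d + 1) (hed : d ≤ e + 1) :
    2 * e - 2 * d = sectorDiff (sector u v) (sector u w) +
      sectorDiff (sector u w) (sector v w) := by
  obtain ⟨u1, u2⟩ := u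
  obtain ⟨v1, v2⟩ := v
  obtain ⟨w1, w2⟩ := w
  simp only [IsUnitStep] at h h'
  rcases (by omega : e = d ∨ e = d + 1 ∨ e = d - 1) with rfl | rfl | rfl <;>
  rcases h with ⟨h, rfl, rfl⟩ | ⟨h, rfl, rfl⟩ | ⟨h, rfl, rfl⟩ | ⟨h, rfl, rfl⟩ <;>
  rcases h' with ⟨h', rfl, rfl⟩ | ⟨h', rfl, rfl⟩ | ⟨h', rfl, rfl⟩ | ⟨h', rfl, rfl⟩ <;>
  first
  | (exfalso; omega)
  | (simp [sector, sectorDiff, ← two_mul]; try omega)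

/-- The direction of the chord from `z i` to `z (i + 1 + m)` in units of 45°, lifted continuously
to the integers starting from the direction of the step at `z i`. -/
def chordAngle (z : ℕ → ℤ × ℤ) (T : ℕ → ℤ) (i : ℕ) : ℕ → ℤ
  | 0 => 2 * T i
  | m + 1 => chordAngle z T i m +
      sectorDiff (sector (z i) (z (i + 1 + m))) (sector (z i) (z (i + 2 + m)))

variable {z : ℕ → ℤ × ℤ} {T : ℕ → ℤ} {L : ℕ}

theorem chordAngle_succ_left (step : ∀ i, IsUnitStep (T i) (z i) (z (i + 1)))
    (turn : ∀ i, T (i + 1) ≤ T i + 1 ∧ T i ≤ T (i + 1) + 1)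
    (inj : ∀ i j, i < j → j < i + L → z j ≠ z i) (i m : ℕ) (hm : m + 2 < L) :
    chordAngle z T (i + 1) m = chordAngle z T i (m + 1) +
      sectorDiff (sector (z i) (z (i + 2 + m))) (sector (z (i + 1)) (z (i + 2 + m))) := by
  induction m with
  | zero =>
    have := sectorDiff_of_turn (step i) (step (i + 1)) (turn i).1 (turn i).2
    simp only [chordAngle, Nat.add_zero]
    rw [add_assoc i 1 1] at this
    linarith
  | succ m ih =>
    have ih := ih (by omega)
    have a1 := abs_sectorDiff_left (step i) (u := z (i + 2 + m))
      (inj _ _ (by omega) (by omega)).symm (inj _ _ (by omega) (by omega)).symm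
    have a2 := abs_sectorDiff_left (step i) (u := z (i + 2 + (m + 1)))
      (inj _ _ (by omega) (by omega)).symm (inj _ _ (by omega) (by omega)).symm
    have a3 := abs_sectorDiff_right (step (i + 2 + m)) (u := z i)
      (inj _ _ (by omega) (by omega)) (inj _ _ (by omega) (by omega))
    have a4 := abs_sectorDiff_right (step (i + 2 + m)) (u := z (i + 1))
      (inj _ _ (by omega) (by omega)) (inj _ _ (by omega) (by omega))
    rw [chordAngle, chordAngle, ih]
    simp only [show i + 1 + 1 + m = i + 2 + m by omega, show i + 1 + 2 + m = i + 3 + m by omega,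
      show i + 1 + (m + 1) = i + 2 + m by omega, show i + 2 + (m + 1) = i + 3 + m by omega,
      show i + 2 + m + 1 = i + 3 + m by omega] at *
    simp only [sectorDiff] at *
    omega

/-- Discrete Hopf turning theorem: the total turning of a simple closed lattice curve is not
zero. Version for a periodic curve with a lowest, then leftmost, point at index 0. -/
theorem false_of_periodic_of_lowest (hL : 3 ≤ L)
    (step : ∀ i, IsUnitStep (T i) (z i) (z (i + 1)))
    (turn : ∀ i, T (i + 1) ≤ T i + 1 ∧ T i ≤ T (i + 1) + 1)
    (inj : ∀ i j, i < j → j < i + L → z j ≠ z i) (hz : z L = z 0) (hT : T L = T 0)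
    (low : ∀ j < L, (z 0).2 < (z j).2 ∨ (z 0).2 = (z j).2 ∧ (z 0).1 ≤ (z j).1) : False := by
  have row : ∀ m, m + 1 < L →
      chordAngle z T 0 m = 2 * T 0 + sector (z 0) (z (m + 1)) - sector (z 0) (z 1) := by
    intro m hm
    induction m with
    | zero => simp [chordAngle]
    | succ m ih =>
      have s1 : 0 ≤ sector (z 0) (z (m + 1)) ∧ sector (z 0) (z (m + 1)) ≤ 3 := by
        have := low (m + 1) (by omega)
        have h2 : ¬ ((z (m + 1)).1 = (z 0).1 ∧ (z (m + 1)).2 = (z 0).2) :=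
          fun h => inj 0 (m + 1) (by omega) (by omega) (Prod.ext h.1 h.2)
        unfold sector
        split_ifs <;> omega
      have s2 : 0 ≤ sector (z 0) (z (m + 2)) ∧ sector (z 0) (z (m + 2)) ≤ 3 := by
        have := low (m + 2) (by omega)
        have h2 : ¬ ((z (m + 2)).1 = (z 0).1 ∧ (z (m + 2)).2 = (z 0).2) :=
          fun h => inj 0 (m + 2) (by omega) (by omega) (Prod.ext h.1 h.2)
        unfold sector
        split_ifs <;> omega
      rw [chordAngle, ih (by omega)]
      simp only [show 0 + 1 + m = m + 1 by omega, show 0 + 2 + m = m + 2 by omega, sectorDiff]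
      simp only [show m + 1 + 1 = m + 2 by omega]
      omega
  have col : ∀ i m, i + m + 2 = L →
      chordAngle z T (i + 1) m = chordAngle z T 1 (L - 2) + sector (z (i + 1)) (z 0)
        - sector (z 1) (z 0) := by
    intro i
    induction i with
    | zero =>
      intro m hm
      obtain rfl : m = L - 2 := by omega
      simp
    | succ i ih =>
      intro m hm
      have s1 : 4 ≤ sector (z (i + 1)) (z 0) ∧ sector (z (i + 1)) (z 0) ≤ 7 := by
        have := low (i + 1) (by omega)
        unfold sector
        split_ifs <;> omega
      have s2 : 4 ≤ sector (z (i + 2)) (z 0) ∧ sector (z (i + 2)) (z 0) ≤ 7 := by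
        have := low (i + 2) (by omega)
        unfold sector
        split_ifs <;> omega
      rw [chordAngle_succ_left step turn inj (i + 1) m (by omega), ih (m + 1) (by omega)]
      rw [show i + 1 + 2 + m = L by omega, hz]
      simp only [show i + 1 + 1 = i + 2 by omega, sectorDiff]
      omega
  obtain ⟨K, rfl⟩ := Nat.exists_eq_add_of_le hL
  have e1 := row (K + 1) (by omega)
  have e2 := col (K + 1) 0 (by omega)
  have e3 := chordAngle_succ_left step turn inj 0 K (by omega)
  have e4 : chordAngle z T 1 (K + 1) = chordAngle z T 1 K +
      sectorDiff (sector (z 1) (z (1 + 1 + K))) (sector (z 1) (z (1 + 2 + K))) := rfl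
  have e5 : chordAngle z T (K + 2) 0 = 2 * T (K + 2) := rfl
  have st0 := step 0
  have st1 := step (K + 2)
  have tn := turn (K + 2)
  have l1 := low 1 (by omega)
  have l2 := low (K + 2) (by omega)
  have i1 := inj 1 (K + 2) (by omega) (by omega)
  simp only [show 3 + K - 2 = K + 1 by omega, show K + 1 + 1 = K + 2 by omega,
    show 0 + 2 + K = K + 2 by omega,
    show 1 + 2 + K = 3 + K by omega, show K + 2 + 1 = 3 + K by omega, zero_add, hz, hT,
    e5] at *
  clear row col step turn inj low
  generalize z 0 = a at *
  generalize z 1 = b at *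
  generalize z (K + 2) = c at *
  obtain ⟨a1, a2⟩ := a
  obtain ⟨b1, b2⟩ := b
  obtain ⟨c1, c2⟩ := c
  have hbc : ¬ (c1 = b1 ∧ c2 = b2) := by simpa using i1
  simp only [IsUnitStep] at st0 st1 l1 l2
  rcases (by omega : (b1 = a1 + 1 ∧ b2 = a2 ∧ c1 = a1 ∧ c2 = a2 + 1) ∨
    (b1 = a1 ∧ b2 = a2 + 1 ∧ c1 = a1 + 1 ∧ c2 = a2)) with ⟨rfl, rfl, rfl, rfl⟩ | ⟨rfl, rfl, rfl, rfl⟩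
  · simp [sector, sectorDiff] at e1 e2 e3 e4
    omega
  · simp [sector, sectorDiff] at e1 e2 e3 e4
    omega

end TurnChain

namespace TurnChain

variable {z : ℕ → ℤ × ℤ} {T : ℕ → ℤ} {L : ℕ}

theorem false_of_periodic (hL : 3 ≤ L) (step : ∀ i, IsUnitStep (T i) (z i) (z (i + 1)))
    (turn : ∀ i, T (i + 1) ≤ T i + 1 ∧ T i ≤ T (i + 1) + 1)
    (inj : ∀ i j, i < j → j < i + L → z j ≠ z i) (hz : ∀ i, z (i + L) = z i)
    (hT : ∀ i, T (i + L) = T i) : False := by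
  obtain ⟨k, hk, hmin⟩ := Finset.exists_min_image (Finset.range L)
    (fun i => toLex ((z i).2, (z i).1)) ⟨0, by simp; omega⟩
  have low : ∀ j < L, (z k).2 < (z j).2 ∨ (z k).2 = (z j).2 ∧ (z k).1 ≤ (z j).1 := by
    intro j hj
    have := hmin j (by simpa using hj)
    rwa [Prod.Lex.le_iff] at this
  simp only [Finset.mem_range] at hk
  refine false_of_periodic_of_lowest (z := fun i => z (k + i)) (T := fun i => T (k + i)) hL
    (fun i => step (k + i)) (fun i => turn (k + i))
    (fun i j h1 h2 => inj (k + i) (k + j) (by omega) (by omega)) (hz k) (hT k) ?_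
  intro j hj
  rcases Nat.lt_or_ge (k + j) L with h | h
  · exact low _ h
  · have := low (k + j - L) (by omega)
    rwa [← hz (k + j - L), Nat.sub_add_cancel h] at this

/-- A simple closed lattice curve has nonzero total turning. -/
theorem false_of_closed (hL : 3 ≤ L) (step : ∀ i < L, IsUnitStep (T i) (z i) (z (i + 1)))
    (turn : ∀ i, i + 1 < L → T (i + 1) ≤ T i + 1 ∧ T i ≤ T (i + 1) + 1)
    (turn' : T 0 ≤ T (L - 1) + 1 ∧ T (L - 1) ≤ T 0 + 1)
    (inj : ∀ i j, i < j → j < L → z j ≠ z i) (hz : z L = z 0) : False := by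
  have succ_mod : ∀ i, (i % L + 1 < L ∧ (i + 1) % L = i % L + 1) ∨
      (i % L = L - 1 ∧ (i + 1) % L = 0) := by
    intro i
    have h1 := Nat.mod_lt i (by omega : 0 < L)
    rcases Nat.lt_or_ge (i % L + 1) L with h | h
    · left
      refine ⟨h, ?_⟩
      rw [Nat.add_mod, Nat.mod_eq_of_lt (by omega : 1 < L), Nat.mod_eq_of_lt h]
    · right
      refine ⟨by omega, ?_⟩
      rw [Nat.add_mod, Nat.mod_eq_of_lt (by omega : 1 < L), show i % L + 1 = L by omega,
        Nat.mod_self]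
  refine false_of_periodic (z := fun i => z (i % L)) (T := fun i => T (i % L)) hL ?_ ?_ ?_ ?_ ?_
  · intro i
    have := step (i % L) (Nat.mod_lt i (by omega))
    rcases succ_mod i with ⟨-, h2⟩ | ⟨h1, h2⟩
    · rwa [h2]
    · rwa [show i % L + 1 = L by omega, hz, ← h2] at this
  · intro i
    rcases succ_mod i with ⟨h1, h2⟩ | ⟨h1, h2⟩
    · rw [h2]; exact turn _ h1
    · rw [h2, h1]; exact turn'
  · intro i j hij hj
    have hi' := Nat.mod_lt i (by omega : 0 < L)
    have hj' := Nat.mod_lt j (by omega : 0 < L)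
    have hne : i % L ≠ j % L := by
      intro h
      have hd : L ∣ j - i := (Nat.modEq_iff_dvd' hij.le).1 h
      have := Nat.le_of_dvd (by omega) hd
      omega
    rcases lt_or_gt_of_ne hne with h | h
    · exact inj _ _ h hj'
    · exact (inj _ _ h hi').symm
  · intro i
    simp
  · intro i
    simp

/-- A simple lattice path whose directions stay within one full turn starting and ending at east
cannot end on the horizontal ray to the right of its start, unless it is straight. -/
theorem straight_of_path {N : ℕ} {c : ℤ} (step : ∀ i < N, IsUnitStep (T i) (z i) (z (i + 1)))
    (turn : ∀ i, i + 1 < N → T (i + 1) ≤ T i + 1 ∧ T i ≤ T (i + 1) + 1)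
    (inj : ∀ i j, i < j → j ≤ N → z j ≠ z i) (hc : ∀ i < N, 4 * c ≤ T i ∧ T i ≤ 4 * c + 4)
    (d : ℕ) (hd : 0 < d) (i j : ℕ) (hij : i ≤ j) (hj : j ≤ N) (h1 : (z j).1 = (z i).1 + d)
    (h2 : (z j).2 = (z i).2) : ∀ t, i ≤ t → t < j → T t % 4 = 0 := by
  induction d using Nat.strong_induction_on generalizing i j with
  | _ d ih =>
  by_contra hne
  push Not at hne
  obtain ⟨t, hit, htj, ht⟩ := hne
  have gap : ∀ k, i ≤ k → k ≤ j → (z k).2 = (z i).2 → (z i).1 < (z k).1 →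
      (z k).1 < (z j).1 → False := by
    intro k hik hkj e l1 l2
    rcases Nat.lt_or_ge t k with h | h
    · exact ht (ih ((z k).1 - (z i).1).toNat (by omega) (by omega) i k hik (by omega) (by omega) e
        t hit h)
    · exact ht (ih ((z j).1 - (z k).1).toNat (by omega) (by omega) k j hkj hj (by omega)
        (by omega) t h htj)
  have first : T i % 4 ≠ 0 := by
    intro h0
    have s := step i (by omega)
    simp only [IsUnitStep] at s
    rcases Nat.lt_or_ge (i + 1) j with h | h
    · have := fun e1 e2 => inj (i + 1) j h hj (Prod.ext e1 e2)
      by_cases hd1 : d = 1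
      · exact this (by omega) (by omega)
      · exact gap (i + 1) (by omega) (by omega) (by omega) (by omega) (by omega)
    · obtain rfl : t = i := by omega
      exact ht h0
  have last : T (j - 1) % 4 ≠ 0 := by
    intro h0
    have s := step (j - 1) (by omega)
    rw [show j - 1 + 1 = j by omega] at s
    simp only [IsUnitStep] at s
    rcases Nat.lt_or_ge i (j - 1) with h | h
    · have := fun e1 e2 => inj i (j - 1) h (by omega) (Prod.ext e1 e2)
      by_cases hd1 : d = 1
      · exact this (by omega) (by omega)
      · exact gap (j - 1) (by omega) (by omega) (by omega) (by omega) (by omega)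
    · obtain rfl : t = j - 1 := by omega
      exact ht h0
  have hci := hc i (by omega)
  have hcj := hc (j - 1) (by omega)
  have hn2 : i + 1 < j := by
    by_contra hlt
    have s := step i (by omega)
    obtain rfl : j = i + 1 := by omega
    simp only [IsUnitStep] at s
    omega
  obtain ⟨m, rfl⟩ := Nat.exists_eq_add_of_le hij
  have hzl : ∀ k ≤ m, (fun k => if k ≤ m then z (i + k) else
      ((z (i + m)).1 - ((k - m : ℕ) : ℤ), (z (i + m)).2)) k = z (i + k) := fun k hk => if_pos hk
  have hzr : ∀ k, m ≤ k → (fun k => if k ≤ m then z (i + k) else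
      ((z (i + m)).1 - ((k - m : ℕ) : ℤ), (z (i + m)).2)) k =
      ((z (i + m)).1 - ((k - m : ℕ) : ℤ), (z (i + m)).2) := by
    intro k hk
    rcases hk.eq_or_lt with rfl | hk
    · simp
    · exact if_neg (by omega)
  have hTl : ∀ k < m, (fun k => if k < m then T (i + k) else 4 * c + 2) k = T (i + k) :=
    fun k hk => if_pos hk
  have hTr : ∀ k, m ≤ k → (fun k => if k < m then T (i + k) else 4 * c + 2) k = 4 * c + 2 :=
    fun k hk => if_neg (by omega)
  generalize (fun k => if k ≤ m then z (i + k) else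
      ((z (i + m)).1 - ((k - m : ℕ) : ℤ), (z (i + m)).2)) = w at hzl hzr
  generalize (fun k => if k < m then T (i + k) else 4 * c + 2) = U at hTl hTr
  refine false_of_closed (L := m + d) (z := w) (T := U) (by omega) ?_ ?_ ?_ ?_ ?_
  · intro k hk
    rcases Nat.lt_or_ge k m with h | h
    · rw [hTl k h, hzl k h.le, hzl (k + 1) h]
      exact step (i + k) (by omega)
    · rw [hTr k h, hzr k h, hzr (k + 1) (by omega)]
      right; right; left
      refine ⟨by omega, ?_, rfl⟩
      simp only
      omega
  · intro k hk
    rcases lt_trichotomy (k + 1) m with h | h | h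
    · rw [hTl k (by omega), hTl (k + 1) h]
      exact turn (i + k) (by omega)
    · rw [hTl k (by omega), hTr (k + 1) h.ge]
      rw [show i + m - 1 = i + k by omega] at last hcj
      omega
    · rw [hTr k (by omega), hTr (k + 1) h.le]
      omega
  · rw [hTl 0 (by omega), hTr (m + d - 1) (by omega), Nat.add_zero]
    omega
  · intro k l hkl hl
    rcases Nat.lt_or_ge m l with h | h
    · rw [hzr l h.le]
      intro e
      have e1 := congrArg Prod.fst e
      have e2 := congrArg Prod.snd e
      rcases Nat.lt_or_ge m k with h' | h'
      · rw [hzr k h'.le] at e1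
        simp only at e1
        omega
      · rw [hzl k h'] at e1 e2
        simp only at e1 e2
        exact gap (i + k) (by omega) (by omega) (by omega) (by omega) (by omega)
    · rw [hzl l h, hzl k (by omega)]
      exact inj _ _ (by omega) (by omega)
  · rw [hzr _ (by omega), hzl 0 (by omega)]
    ext
    · simp only [Nat.add_zero]
      omega
    · exact h2

end TurnChain

namespace TurnChain

variable {n : ℕ} {D : ℕ → ℤ} {P : ℕ → ℤ × ℤ}

/-- The lattice points of a nondegenerate segment. -/
theorem IsStep.exists_path {d : ℤ} {u v : ℤ × ℤ} (h : IsStep d u v) :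
    ∃ (l : ℕ) (w : ℕ → ℤ × ℤ), 0 < l ∧ w 0 = u ∧ w l = v ∧
      (∀ s < l, IsUnitStep d (w s) (w (s + 1))) ∧ (∀ s ≤ l, w s ∈ segSet u v) ∧
      ∀ s t, s < t → t ≤ l → w t ≠ w s := by
  obtain ⟨u1, u2⟩ := u
  obtain ⟨v1, v2⟩ := v
  rcases h with h | h | h | h <;> simp only at h
  · refine ⟨(v1 - u1).toNat, fun s => (u1 + s, u2), by omega, by simp, ?_, ?_, ?_, ?_⟩
    all_goals simp only [mem_segSet, IsUnitStep, ne_eq, Prod.mk.injEq, and_true]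
    all_goals try intro s
    all_goals try intro t
    all_goals omega
  · refine ⟨(v2 - u2).toNat, fun s => (u1, u2 + s), by omega, by simp, ?_, ?_, ?_, ?_⟩
    all_goals simp only [mem_segSet, IsUnitStep, ne_eq, Prod.mk.injEq, true_and]
    all_goals try intro s
    all_goals try intro t
    all_goals omega
  · refine ⟨(u1 - v1).toNat, fun s => (u1 - s, u2), by omega, by simp, ?_, ?_, ?_, ?_⟩
    all_goals simp only [mem_segSet, IsUnitStep, ne_eq, Prod.mk.injEq, and_true]
    all_goals try intro s
    all_goals try intro t
    all_goals omega
  · refine ⟨(u2 - v2).toNat, fun s => (u1, u2 - s), by omega, by simp, ?_, ?_, ?_, ?_⟩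
    all_goals simp only [mem_segSet, IsUnitStep, ne_eq, Prod.mk.injEq, true_and]
    all_goals try intro s
    all_goals try intro t
    all_goals omega

/-- The lattice path traversed by the first `m` segments of a chain. -/
theorem IsRealization.exists_path (h : IsRealization n D P) (hD : IsTurnWord n D) (m : ℕ)
    (hm : m ≤ n + 1) : ∃ (N : ℕ) (z : ℕ → ℤ × ℤ) (T : ℕ → ℤ), z 0 = P 0 ∧ z N = P m ∧
      (∀ t < N, IsUnitStep (T t) (z t) (z (t + 1))) ∧
      (∀ t < N, ∃ k < m, T t = D k ∧ z t ∈ segSet (P k) (P (k + 1)) ∧ z t ≠ P (k + 1)) ∧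
      (∀ s t, s < t → t ≤ N → z t ≠ z s) ∧
      (∀ t, t + 1 < N → T (t + 1) ≤ T t + 1 ∧ T t ≤ T (t + 1) + 1) ∧
      (0 < m → 0 < N ∧ T (N - 1) = D (m - 1)) ∧ ∀ k < m, ∃ t < N, T t = D k := by
  induction m with
  | zero => exact ⟨0, P, D, rfl, rfl, by omega, by omega, by omega, by omega, by omega, by omega⟩
  | succ m ih =>
    obtain ⟨N, z, T, z0, zN, step, mem, inj, turn, last, surj⟩ := ih (by omega)
    obtain ⟨l, w, hl, w0, wl, wstep, wmem, winj⟩ := (h.isStep m (by omega)).exists_path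
    have hzl : ∀ k ≤ N, (fun k => if k ≤ N then z k else w (k - N)) k = z k :=
      fun k hk => if_pos hk
    have hzr : ∀ k, (fun k => if k ≤ N then z k else w (k - N)) (N + k) = w k := by
      intro k
      rcases Nat.eq_zero_or_pos k with rfl | hk
      · simp [w0, zN]
      · simp [hk.ne']
    have hTl : ∀ k < N, (fun k => if k < N then T k else D m) k = T k := fun k hk => if_pos hk
    have hTr : ∀ k, (fun k => if k < N then T k else D m) (N + k) = D m :=
      fun k => if_neg (by omega)
    generalize (fun k => if k ≤ N then z k else w (k - N)) = z' at hzl hzr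
    generalize (fun k => if k < N then T k else D m) = T' at hTl hTr
    refine ⟨N + l, z', T', ?_, ?_, ?_, ?_, ?_, ?_, ?_, ?_⟩
    · rw [hzl 0 (by omega), z0]
    · rw [hzr, wl]
    · intro t ht
      rcases Nat.lt_or_ge t N with h' | h'
      · rw [hTl t h', hzl t h'.le, hzl (t + 1) h']
        exact step t h'
      · obtain ⟨k, rfl⟩ := Nat.exists_eq_add_of_le h'
        rw [hTr, hzr, Nat.add_assoc, hzr]
        exact wstep k (by omega)
    · intro t ht
      rcases Nat.lt_or_ge t N with h' | h'
      · rw [hTl t h', hzl t h'.le]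
        obtain ⟨k, hk, h1⟩ := mem t h'
        exact ⟨k, by omega, h1⟩
      · obtain ⟨k, rfl⟩ := Nat.exists_eq_add_of_le h'
        rw [hTr, hzr]
        refine ⟨m, by omega, rfl, wmem k (by omega), ?_⟩
        rw [← wl]
        exact (winj k l (by omega) le_rfl).symm
    · intro s t hst ht
      rcases Nat.lt_or_ge s N with hs | hs
      · rw [hzl s hs.le]
        rcases Nat.lt_or_ge N t with h' | h'
        · obtain ⟨k, rfl⟩ := Nat.exists_eq_add_of_le h'.le
          rw [hzr]
          intro e
          obtain ⟨i, hi, -, h1, h2⟩ := mem s hs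
          have h3 := wmem k (by omega)
          rw [e] at h3
          rcases h.corner hD (by omega) (by omega) hi.ne h1 h3 with ⟨-, h4⟩ | ⟨h4, -⟩
          · exact h2 h4
          · omega
        · rw [hzl t h']
          exact inj s t hst h'
      · obtain ⟨k, rfl⟩ := Nat.exists_eq_add_of_le hs
        obtain ⟨k', rfl⟩ := Nat.exists_eq_add_of_le (hs.trans hst.le)
        rw [hzr, hzr]
        exact winj _ _ (by omega) (by omega)
    · intro t ht
      rcases lt_trichotomy (t + 1) N with h' | h' | h'
      · rw [hTl t (by omega), hTl _ h']
        exact turn t h'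
      · have e := hTr 0
        rw [Nat.add_zero, ← h'] at e
        rw [hTl t (by omega), e]
        have hm0 : 0 < m := by
          by_contra h0
          obtain rfl : m = 0 := by omega
          obtain ⟨k, hk, -⟩ := mem t (by omega)
          omega
        have h1 := (last hm0).2
        rw [show N - 1 = t by omega] at h1
        have h2 := hD (m - 1) (by omega)
        rw [show m - 1 + 1 = m by omega] at h2
        omega
      · obtain ⟨k, rfl⟩ := Nat.exists_eq_add_of_le (show N ≤ t by omega)
        rw [hTr, Nat.add_assoc, hTr]
        omega
    · intro _
      refine ⟨by omega, ?_⟩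
      rw [show N + l - 1 = N + (l - 1) by omega, hTr, Nat.add_sub_cancel]
    · intro k hk
      rcases Nat.lt_or_ge k m with h' | h'
      · obtain ⟨t, ht, e⟩ := surj k h'
        exact ⟨t, by omega, by rw [hTl t ht, e]⟩
      · obtain rfl : k = m := by omega
        exact ⟨N, by omega, hTr 0⟩

/-- A word without right hooks stays within one full turn starting and ending at east. -/
theorem bounds_of_not_hook (hD : IsTurnWord n D) (hn : 1 ≤ n) (hH : ¬ Hook n D 0) :
    ∃ c, ∀ i ≤ n, 4 * c ≤ D i ∧ D i ≤ 4 * c + 4 := by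
  obtain ⟨c, h0, h1⟩ : ∃ c, (4 * c ≤ D 0 ∧ D 0 ≤ 4 * c + 4) ∧
      (4 * c ≤ D 1 ∧ D 1 ≤ 4 * c + 4) := by
    have := hD 0 hn
    rw [Nat.zero_add] at this
    by_cases hc : D 0 % 4 = 0 ∧ D 1 = D 0 - 1
    · exact ⟨D 0 / 4 - 1, by omega, by omega⟩
    · exact ⟨D 0 / 4, by omega, by omega⟩
  have key : ∀ i, i + 1 ≤ n → (4 * c ≤ D i ∧ D i ≤ 4 * c + 4) ∧
      (4 * c ≤ D (i + 1) ∧ D (i + 1) ≤ 4 * c + 4) := by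
    intro i
    induction i with
    | zero => exact fun _ => ⟨h0, h1⟩
    | succ i ih =>
      intro hi
      obtain ⟨h2, h3⟩ := ih (by omega)
      refine ⟨h3, ?_⟩
      have e1 := hD i (by omega)
      have e2 := hD (i + 1) (by omega)
      have e3 : D (i + 2) ≠ D i → D (i + 1) % 4 = 0 → False := fun a b => hH ⟨i, hi, a, b⟩
      rw [show i + 1 + 1 = i + 2 from rfl] at *
      by_cases e4 : D (i + 1) % 4 = 0
      · by_cases e5 : D (i + 2) = D i
        · omega
        · exact (e3 e5 e4).elim
      · omega
  refine ⟨c, fun i hi => ?_⟩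
  rcases Nat.eq_zero_or_pos i with rfl | h'
  · exact h0
  · have := (key (i - 1) (by omega)).2
    rwa [show i - 1 + 1 = i by omega] at this

theorem hook_of_reach (hn : 1 ≤ n) (hD : IsTurnWord n D) {a : ℤ} (ha : 0 < a)
    (h : (a, 0) ∈ Reach n D) : Hook n D 0 := by
  by_contra hH
  obtain ⟨c, hc⟩ := bounds_of_not_hook hD hn hH
  obtain ⟨P, hP, e1, e2⟩ := h
  obtain ⟨N, z, T, z0, zN, step, mem, inj, turn, -, surj⟩ := hP.exists_path hD (n + 1) le_rfl
  have hT : ∀ t < N, 4 * c ≤ T t ∧ T t ≤ 4 * c + 4 := by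
    intro t ht
    obtain ⟨k, hk, e, -⟩ := mem t ht
    rw [e]
    exact hc k (by omega)
  simp only at e1 e2
  have key := straight_of_path step turn inj hT a.toNat (by omega) 0 N (by omega) le_rfl
    (by rw [z0, zN]; omega) (by rw [z0, zN]; omega)
  obtain ⟨t0, ht0, h0⟩ := surj 0 (by omega)
  obtain ⟨t1, ht1, h1⟩ := surj 1 (by omega)
  have k0 := key t0 (by omega) ht0
  have k1 := key t1 (by omega) ht1
  have := hD 0 hn
  rw [Nat.zero_add] at this
  omega

end TurnChain

namespace TurnChain

variable {n : ℕ} {D : ℕ → ℤ} {P : ℕ → ℤ × ℤ}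

theorem reach_mirror {x y : ℤ} :
    (x, y) ∈ Reach n (fun i => 2 - D i) ↔ (-x, y) ∈ Reach n D := by
  rw [show (fun i => 2 - D i) = fun i => (fun i => 1 - D i) i + 1 by funext i; ring, reach_rot,
    reach_swap]

theorem hook_one_sub {d e : ℤ} (hd : 0 ≤ d ∧ d < 4) (he : (1 - d) % 4 = e) :
    Hook n (fun i => 1 - D i) d ↔ Hook n D e := by
  simp only [Hook]
  refine exists_congr fun k => ?_
  omega

theorem hook_two_sub {d e : ℤ} (hd : 0 ≤ d ∧ d < 4) (he : (2 - d) % 4 = e) :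
    Hook n (fun i => 2 - D i) d ↔ Hook n D e := by
  simp only [Hook]
  refine exists_congr fun k => ?_
  omega

theorem exists_reach_right_iff (hn : 1 ≤ n) (hD : IsTurnWord n D) :
    (∃ a : ℤ, 0 < a ∧ (a, 0) ∈ Reach n D) ↔ Hook n D 0 :=
  ⟨fun ⟨_, ha, h⟩ => hook_of_reach hn hD ha h, exists_reach_of_hook hD⟩

theorem exists_reach_left_iff (hn : 1 ≤ n) (hD : IsTurnWord n D) :
    (∃ a : ℤ, a < 0 ∧ (a, 0) ∈ Reach n D) ↔ Hook n D 2 := by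
  rw [← hook_two_sub (d := 0) (by omega) (by norm_num), ← exists_reach_right_iff hn hD.two_sub]
  simp only [reach_mirror]
  exact ⟨fun ⟨a, ha, h⟩ => ⟨-a, by omega, by rwa [neg_neg]⟩,
    fun ⟨a, ha, h⟩ => ⟨-a, by omega, h⟩⟩

theorem exists_reach_up_iff (hn : 1 ≤ n) (hD : IsTurnWord n D) :
    (∃ b : ℤ, 0 < b ∧ (0, b) ∈ Reach n D) ↔ Hook n D 1 := by
  rw [← hook_one_sub (d := 0) (by omega) (by norm_num), ← exists_reach_right_iff hn hD.one_sub]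
  simp only [reach_swap]

theorem exists_reach_down_iff (hn : 1 ≤ n) (hD : IsTurnWord n D) :
    (∃ b : ℤ, b < 0 ∧ (0, b) ∈ Reach n D) ↔ Hook n D 3 := by
  rw [← hook_one_sub (d := 2) (by omega) (by norm_num), ← exists_reach_left_iff hn hD.one_sub]
  simp only [reach_swap]

theorem reach_right (hn : 1 ≤ n) (hD : IsTurnWord n D) {a x : ℤ} (ha : 0 < a) (hx : a ≤ x)
    (h : (a, 0) ∈ Reach n D) (y : ℤ) : (x, y) ∈ Reach n D :=
  reach_halfplane hn hD ha hx h y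

theorem reach_left (hn : 1 ≤ n) (hD : IsTurnWord n D) {a x : ℤ} (ha : a < 0) (hx : x ≤ a)
    (h : (a, 0) ∈ Reach n D) (y : ℤ) : (x, y) ∈ Reach n D := by
  have := reach_halfplane hn hD.two_sub (a := -a) (a' := -x) (by omega) (by omega)
    (reach_mirror.2 (by rwa [neg_neg])) y
  rwa [reach_mirror, neg_neg] at this

theorem reach_up (hn : 1 ≤ n) (hD : IsTurnWord n D) {b y : ℤ} (hb : 0 < b) (hy : b ≤ y)
    (h : (0, b) ∈ Reach n D) (x : ℤ) : (x, y) ∈ Reach n D :=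
  reach_swap.1 (reach_right hn hD.one_sub hb hy (reach_swap.2 h) x)

theorem reach_down (hn : 1 ≤ n) (hD : IsTurnWord n D) {b y : ℤ} (hb : b < 0) (hy : y ≤ b)
    (h : (0, b) ∈ Reach n D) (x : ℤ) : (x, y) ∈ Reach n D :=
  reach_swap.1 (reach_left hn hD.one_sub hb hy (reach_swap.2 h) x)

/-- A reachable point projects to a reachable point of one of the axes. -/
theorem reach_axis (hD : IsTurnWord n D) (hH : ∃ k, k + 2 ≤ n ∧ D (k + 2) ≠ D k) {x y : ℤ}
    (h : (x, y) ∈ Reach n D) :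
    (x ≠ 0 ∧ (x, 0) ∈ Reach n D) ∨ (y ≠ 0 ∧ (0, y) ∈ Reach n D) := by
  by_cases hx : x = 0
  · by_cases hy : y = 0
    · subst hx hy
      obtain ⟨P, hP, e1, e2⟩ := h
      simp only [add_zero] at e1 e2
      exact absurd (Prod.ext e1 e2) (last_ne_start hP hD (Nat.zero_le n))
    · subst hx
      exact Or.inr ⟨hy, h⟩
  by_cases hy : y = 0
  · subst hy
    exact Or.inl ⟨hx, h⟩
  have upper : ∀ {E : ℕ → ℤ}, IsTurnWord n E → (∃ k, k + 2 ≤ n ∧ E (k + 2) ≠ E k) → ∀ {y : ℤ},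
      0 < y → (x, y) ∈ Reach n E → (x, 0) ∈ Reach n E ∨ (0, y) ∈ Reach n E := by
    intro E hE hHE y hy h
    rcases lt_or_gt_of_ne hx with hx | hx
    · obtain ⟨k, hk, hkE⟩ := hHE
      have := reach_axis_of_reach hE.two_sub ⟨k, hk, by omega⟩ (x := -x)
        (by omega) hy (reach_mirror.2 (by rwa [neg_neg]))
      rwa [reach_mirror, reach_mirror, neg_neg, neg_zero] at this
    · exact reach_axis_of_reach hE hHE hx hy h
  have : (x, 0) ∈ Reach n D ∨ (0, y) ∈ Reach n D := by
    rcases lt_or_gt_of_ne hy with hy | hy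
    · obtain ⟨k, hk, hkD⟩ := hH
      have := upper hD.neg ⟨k, hk, by omega⟩ (y := -y) (by omega)
        (reach_refl.2 (by rwa [neg_neg]))
      rwa [reach_refl, reach_refl, neg_neg, neg_zero] at this
    · exact upper hD hH hy h
  exact this.imp (⟨hx, ·⟩) (⟨hy, ·⟩)

theorem isStep_iff {d : ℤ} {u v : ℤ × ℤ} : IsStep d u v ↔
    (d % 4 = 0 ∧ unitDir u v = (1, 0)) ∨ (d % 4 = 1 ∧ unitDir u v = (0, 1)) ∨
    (d % 4 = 2 ∧ unitDir u v = (-1, 0)) ∨ (d % 4 = 3 ∧ unitDir u v = (0, -1)) := by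
  simp only [IsStep, unitDir, Prod.mk.injEq, Int.sign_eq_one_iff_pos, Int.sign_eq_zero_iff_zero,
    Int.sign_eq_neg_one_iff_neg]
  omega

theorem delta_succ (σ : List Turn) {i : ℕ} (h : i < σ.length) :
    delta σ (i + 1) = delta σ i + if σ.get ⟨i, h⟩ = Turn.L then 1 else -1 := by
  simp only [delta, List.take_add_one, List.getElem?_eq_getElem h, List.get_eq_getElem,
    Option.toList_some, List.count_append]
  have : σ[i] = Turn.L ∨ σ[i] = Turn.R := by cases σ[i] <;> simp
  rcases this with e | e <;> simp [e] <;> ring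

theorem isTurnWord_delta (σ : List Turn) : IsTurnWord σ.length (delta σ) := by
  intro i hi
  rw [delta_succ σ hi]
  split_ifs <;> omega

theorem get_eq_get_iff (σ : List Turn) {k : ℕ} (h : k + 1 < σ.length) :
    σ.get ⟨k, by omega⟩ = σ.get ⟨k + 1, h⟩ ↔ delta σ (k + 2) ≠ delta σ k := by
  rw [delta_succ σ h, delta_succ σ (show k < σ.length by omega)]
  cases σ.get ⟨k, by omega⟩ <;> cases σ.get ⟨k + 1, h⟩ <;> simp <;> omega

theorem hasHook_iff (σ : List Turn) (d : ℤ) : HasHook σ d ↔ Hook σ.length (delta σ) d := by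
  constructor
  · rintro ⟨k, h, e, hd⟩
    exact ⟨k, h, (get_eq_get_iff σ h).1 e, hd⟩
  · rintro ⟨k, h, e, hd⟩
    exact ⟨k, h, (get_eq_get_iff σ h).2 e, hd⟩

theorem isRealization_pts {σ : List Turn} (C : Chain σ) :
    IsRealization σ.length (delta σ) C.pts where
  isStep i hi := by
    induction i with
    | zero =>
      obtain ⟨t, ht, e⟩ := C.first_seg
      left
      rw [e, C.start_eq]
      exact ⟨rfl, rfl, ht⟩
    | succ i ih =>
      have h := isStep_iff.1 (ih (by omega))
      have t := C.turns i hi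
      rw [isStep_iff, delta_succ σ hi, t]
      split_ifs with hL
      · rcases h with ⟨h, e⟩ | ⟨h, e⟩ | ⟨h, e⟩ | ⟨h, e⟩ <;> rw [e] <;>
          simp [rotCCW] <;> omega
      · rcases h with ⟨h, e⟩ | ⟨h, e⟩ | ⟨h, e⟩ | ⟨h, e⟩ <;> rw [e] <;>
          simp [rotCW] <;> omega
  disjoint i j hij hj q h1 h2 := by
    have : q ∈ (∅ : Set (ℤ × ℤ)) := C.simple_nonadj i j hij hj ▸ ⟨h1, h2⟩
    exact this

theorem IsRealization.sub (h : IsRealization n D P) (c : ℤ × ℤ) :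
    IsRealization n D (fun i => P i - c) where
  isStep i hi := by
    have := h.isStep i hi
    simp only [IsStep, Prod.fst_sub, Prod.snd_sub] at this ⊢
    omega
  disjoint i j hij hj q h1 h2 := by
    refine h.disjoint i j hij hj (q + c) ?_ ?_ <;>
      simp only [mem_segSet, Prod.fst_sub, Prod.snd_sub, Prod.fst_add, Prod.snd_add] at h1 h2 ⊢ <;>
      omega

theorem IsRealization.exists_chain {σ : List Turn} (h : IsRealization σ.length (delta σ) P)
    (h0 : P 0 = (0, 0)) : ∃ C : Chain σ, C.pts = P := by
  refine ⟨⟨P, h0, ?_, ?_, ?_, ?_, ?_⟩, rfl⟩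
  · have s := h.isStep 0 (Nat.zero_le _)
    have d0 : delta σ 0 = 0 := rfl
    rw [h0, d0, Nat.zero_add] at s
    simp only [IsStep] at s
    exact ⟨(P 1).1, by omega, Prod.ext rfl (by simp only; omega)⟩
  · intro i hi
    have s := h.isStep i hi
    simp only [IsStep] at s
    omega
  · intro i hi
    have s1 := isStep_iff.1 (h.isStep i hi.le)
    have s2 := isStep_iff.1 (h.isStep (i + 1) hi)
    rw [delta_succ σ hi] at s2
    split_ifs at s2 ⊢ with hL
    all_goals
      rcases s1 with ⟨h1, e1⟩ | ⟨h1, e1⟩ | ⟨h1, e1⟩ | ⟨h1, e1⟩ <;>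
      rcases s2 with ⟨h2, e2⟩ | ⟨h2, e2⟩ | ⟨h2, e2⟩ | ⟨h2, e2⟩ <;>
      first
      | exact absurd h2 (by omega)
      | (rw [e1]; exact e2)
  · intro i hi
    ext q
    constructor
    · rintro ⟨h1, h2⟩
      exact h.adj (isTurnWord_delta σ) hi h1 h2
    · rintro rfl
      exact ⟨IsRealization.right_mem i, IsRealization.left_mem (i + 1)⟩
  · intro i j hij hj
    ext q
    exact ⟨fun hq => h.disjoint i j hij hj q hq.1 hq.2, False.elim⟩

theorem reachSet_eq (σ : List Turn) : ReachSet σ = Reach σ.length (delta σ) := by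
  ext q
  constructor
  · rintro ⟨C, rfl⟩
    refine ⟨C.pts, isRealization_pts C, ?_, ?_⟩ <;> simp [C.start_eq]
  · rintro ⟨P, hP, e1, e2⟩
    obtain ⟨C, hC⟩ := (hP.sub (P 0)).exists_chain (sub_self _)
    refine ⟨C, ?_⟩
    rw [hC]
    ext
    · simp only [Prod.fst_sub]; omega
    · simp only [Prod.snd_sub]; omega

/-- A nonempty set of positive integers has a least element. -/
theorem exists_least {p : ℤ → Prop} {a : ℤ} (ha : 0 < a) (h : p a) :
    ∃ b, 0 < b ∧ p b ∧ (∀ c, 0 < c → p c → b ≤ c) ∧ b ≤ a := by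
  obtain ⟨b, ⟨hb, hpb⟩, hmin⟩ := Int.exists_least_of_bdd (P := fun b => 0 < b ∧ p b)
    ⟨0, fun z hz => hz.1.le⟩ ⟨a, ha, h⟩
  exact ⟨b, hb, hpb, fun c hc hpc => hmin c ⟨hc, hpc⟩, hmin a ⟨ha, h⟩⟩

/-- A nonempty set of negative integers has a greatest element. -/
theorem exists_greatest {p : ℤ → Prop} {a : ℤ} (ha : a < 0) (h : p a) :
    ∃ b, b < 0 ∧ p b ∧ (∀ c, c < 0 → p c → c ≤ b) ∧ a ≤ b := by
  obtain ⟨b, hb, hpb, hmin, hba⟩ := exists_least (p := fun z => p (-z)) (a := -a) (by omega)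
    (by rwa [neg_neg])
  refine ⟨-b, by omega, hpb, fun c hc hpc => ?_, by omega⟩
  have := hmin (-c) (by omega) (by rwa [neg_neg])
  omega

theorem mem_Vplus_of_pos {a : ℤ} (ha : 0 < a) {q : ℤ × ℤ} : q ∈ Vplus (a, 0) ↔ a ≤ q.1 := by
  simp only [Vplus, Set.mem_ofPred_eq, Int.sign_eq_one_of_pos ha, one_mul]
  constructor
  · rintro ⟨i, j, hi, rfl⟩
    simpa using hi
  · exact fun h => ⟨q.1 - a, q.2, by omega, by ext <;> simp⟩

theorem mem_Vplus_of_neg {a : ℤ} (ha : a < 0) {q : ℤ × ℤ} : q ∈ Vplus (a, 0) ↔ q.1 ≤ a := by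
  simp only [Vplus, Set.mem_ofPred_eq, Int.sign_eq_neg_one_of_neg ha]
  constructor
  · rintro ⟨i, j, hi, rfl⟩
    simpa using hi
  · exact fun h => ⟨a - q.1, q.2, by omega, by ext <;> simp⟩

theorem mem_Hplus_of_pos {b : ℤ} (hb : 0 < b) {q : ℤ × ℤ} : q ∈ Hplus (0, b) ↔ b ≤ q.2 := by
  simp only [Hplus, Set.mem_ofPred_eq, Int.sign_eq_one_of_pos hb, one_mul]
  constructor
  · rintro ⟨i, j, hj, rfl⟩
    simpa using hj
  · exact fun h => ⟨q.1, q.2 - b, by omega, by ext <;> simp⟩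

theorem mem_Hplus_of_neg {b : ℤ} (hb : b < 0) {q : ℤ × ℤ} : q ∈ Hplus (0, b) ↔ q.2 ≤ b := by
  simp only [Hplus, Set.mem_ofPred_eq, Int.sign_eq_neg_one_of_neg hb]
  constructor
  · rintro ⟨i, j, hj, rfl⟩
    simpa using hj
  · exact fun h => ⟨q.1, b - q.2, by omega, by ext <;> simp⟩

end TurnChain

/-- **Shape of the reachable set.** If `σ` contains a hook, then reachable points
closest to the origin exist on a signed axis exactly when `σ` contains the
corresponding hook, and `A(σ)` is exactly the union, over the signed axes met by
`A(σ)`, of the halfplanes determined by the closest reachable points on them. -/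
theorem reachable_set_shape (σ : List Turn) (hhook : HasAnyHook σ) :
    ((∃ a : ℤ, 0 < a ∧ (a, (0 : ℤ)) ∈ ReachSet σ) ↔ HasHook σ 0) ∧
    ((∃ a : ℤ, a < 0 ∧ (a, (0 : ℤ)) ∈ ReachSet σ) ↔ HasHook σ 2) ∧
    ((∃ b : ℤ, 0 < b ∧ ((0 : ℤ), b) ∈ ReachSet σ) ↔ HasHook σ 1) ∧
    ((∃ b : ℤ, b < 0 ∧ ((0 : ℤ), b) ∈ ReachSet σ) ↔ HasHook σ 3) ∧
    ReachSet σ =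
      {q : ℤ × ℤ |
        (∃ a : ℤ, 0 < a ∧ (a, (0 : ℤ)) ∈ ReachSet σ ∧
          (∀ a' : ℤ, 0 < a' → (a', (0 : ℤ)) ∈ ReachSet σ → a ≤ a') ∧ q ∈ Vplus (a, 0)) ∨
        (∃ a : ℤ, a < 0 ∧ (a, (0 : ℤ)) ∈ ReachSet σ ∧
          (∀ a' : ℤ, a' < 0 → (a', (0 : ℤ)) ∈ ReachSet σ → a' ≤ a) ∧ q ∈ Vplus (a, 0)) ∨
        (∃ b : ℤ, 0 < b ∧ ((0 : ℤ), b) ∈ ReachSet σ ∧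
          (∀ b' : ℤ, 0 < b' → ((0 : ℤ), b') ∈ ReachSet σ → b ≤ b') ∧ q ∈ Hplus (0, b)) ∨
        (∃ b : ℤ, b < 0 ∧ ((0 : ℤ), b) ∈ ReachSet σ ∧
          (∀ b' : ℤ, b' < 0 → ((0 : ℤ), b') ∈ ReachSet σ → b' ≤ b) ∧
          q ∈ Hplus (0, b))} := by
  obtain ⟨k, hk, hkσ⟩ := hhook
  have hH : ∃ k, k + 2 ≤ σ.length ∧ delta σ (k + 2) ≠ delta σ k :=
    ⟨k, hk, (TurnChain.get_eq_get_iff σ hk).1 hkσ⟩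
  have hn : 1 ≤ σ.length := by omega
  have hD := TurnChain.isTurnWord_delta σ
  simp only [TurnChain.reachSet_eq, TurnChain.hasHook_iff]
  refine ⟨TurnChain.exists_reach_right_iff hn hD, TurnChain.exists_reach_left_iff hn hD,
    TurnChain.exists_reach_up_iff hn hD, TurnChain.exists_reach_down_iff hn hD, ?_⟩
  ext ⟨x, y⟩
  constructor
  · intro h
    rcases TurnChain.reach_axis hD hH h with ⟨hx, h⟩ | ⟨hy, h⟩
    · rcases lt_or_gt_of_ne hx with hx | hx
      · obtain ⟨a, ha, hR, hmax, hxa⟩ := TurnChain.exists_greatest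
          (p := fun a => (a, 0) ∈ TurnChain.Reach σ.length (delta σ)) hx h
        exact Or.inr (Or.inl ⟨a, ha, hR, hmax, (TurnChain.mem_Vplus_of_neg ha).2 hxa⟩)
      · obtain ⟨a, ha, hR, hmin, hxa⟩ := TurnChain.exists_least
          (p := fun a => (a, 0) ∈ TurnChain.Reach σ.length (delta σ)) hx h
        exact Or.inl ⟨a, ha, hR, hmin, (TurnChain.mem_Vplus_of_pos ha).2 hxa⟩
    · rcases lt_or_gt_of_ne hy with hy | hy
      · obtain ⟨b, hb, hR, hmax, hyb⟩ := TurnChain.exists_greatest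
          (p := fun b => (0, b) ∈ TurnChain.Reach σ.length (delta σ)) hy h
        exact Or.inr (Or.inr (Or.inr ⟨b, hb, hR, hmax, (TurnChain.mem_Hplus_of_neg hb).2 hyb⟩))
      · obtain ⟨b, hb, hR, hmin, hyb⟩ := TurnChain.exists_least
          (p := fun b => (0, b) ∈ TurnChain.Reach σ.length (delta σ)) hy h
        exact Or.inr (Or.inr (Or.inl ⟨b, hb, hR, hmin, (TurnChain.mem_Hplus_of_pos hb).2 hyb⟩))
  · rintro (⟨a, ha, hR, -, h⟩ | ⟨a, ha, hR, -, h⟩ | ⟨b, hb, hR, -, h⟩ | ⟨b, hb, hR, -, h⟩)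
    · exact TurnChain.reach_right hn hD ha ((TurnChain.mem_Vplus_of_pos ha).1 h) hR y
    · exact TurnChain.reach_left hn hD ha ((TurnChain.mem_Vplus_of_neg ha).1 h) hR y
    · exact TurnChain.reach_up hn hD hb ((TurnChain.mem_Hplus_of_pos hb).1 h) hR x
    · exact TurnChain.reach_down hn hD hb ((TurnChain.mem_Hplus_of_neg hb).1 h) hR x
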